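/- Let K be an infinite field with char K ≠ 2, and let Q ⊂ K[x_1,...,x_n] be a homogeneous ideal with a 2-linear resolution (reg Q = indeg Q = 2). Then the generic initial ideal Gin(Q) with respect to the reverse lexicographic order induced by x_1 > ... > x_n is generated by quadratic monomials and satisfies: if x_i x_j ∈ Gin(Q) with i ≤ j, then x_i x_k ∈ Gin(Q) for all k < j. -/

import Mathlib

/-- The `j`-th graded component of the graded free module `σ →₀ A` with basis
elements of degrees `deg`. -/
def freeGrading {K A ι : Type} [Field K] [CommRing A] [Algebra K A] [AddCommGroup ι]
    (𝒜 : ι → Submodule K A) {σ : Type} (deg : σ → ι) (j : ι) : Submodule K (σ →₀ A) where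
  carrier := {f | ∀ s, f s ∈ 𝒜 (j - deg s)}
  add_mem' := fun {f g} hf hg s => by
    rw [Finsupp.add_apply]; exact add_mem (hf s) (hg s)
  zero_mem' := fun s => by simp
  smul_mem' := fun c f hf s => by
    rw [Finsupp.smul_apply]; exact Submodule.smul_mem _ c (hf s)

/-- A map of graded modules has degree `0`. -/
def IsGradedMap {K A ι M N : Type} [Field K] [CommRing A] [Algebra K A] [AddCommGroup ι]
    [AddCommGroup M] [Module A M] [AddCommGroup N] [Module A N]
    [Module K M] [Module K N]
    (ℳ : ι → Submodule K M) (𝒩 : ι → Submodule K N) (φ : M →ₗ[A] N) : Prop :=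
  ∀ j : ι, ∀ x ∈ ℳ j, φ x ∈ 𝒩 j

/-- A graded free resolution of the graded module `(M, ℳ)` over the graded algebra
`(A, 𝒜)`, in which the `s`-th free module has basis elements of degrees lying in
the prescribed set `D s`.  The existence of such a resolution with
`D s = {j | j ≤ b s}` is equivalent to the vanishing `Tor_s^A(M, K)_j = 0` for all
`j > b s`, i.e. to `t_s(M) ≤ b s` (for all `s` simultaneously). -/
structure GradedFreeResolution (K A : Type) [Field K] [CommRing A] [Algebra K A]
    {ι : Type} [AddCommGroup ι] (𝒜 : ι → Submodule K A)
    (M : Type) [AddCommGroup M] [Module A M] [Module K M]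
    (ℳ : ι → Submodule K M) (D : ℕ → Set ι) where
  σ : ℕ → Type
  deg : (s : ℕ) → σ s → ι
  deg_mem : ∀ (s : ℕ) (i : σ s), deg s i ∈ D s
  aug : (σ 0 →₀ A) →ₗ[A] M
  d : (s : ℕ) → ((σ (s+1) →₀ A) →ₗ[A] (σ s →₀ A))
  aug_surjective : Function.Surjective aug
  aug_graded : IsGradedMap (K := K) (freeGrading 𝒜 (deg 0)) ℳ aug
  d_graded : ∀ s : ℕ,
    IsGradedMap (K := K) (freeGrading 𝒜 (deg (s+1))) (freeGrading 𝒜 (deg s)) (d s)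
  exact_zero : LinearMap.range (d 0) = LinearMap.ker aug
  exact_succ : ∀ s : ℕ, LinearMap.range (d (s+1)) = LinearMap.ker (d s)

/-- The irrelevant ideal of a graded algebra. -/
def irrelevant {K B ι : Type} [Field K] [CommRing B] [Algebra K B] [AddCommGroup ι]
    (ℬ : ι → Submodule K B) : Ideal B :=
  Ideal.span {x | ∃ i : ι, i ≠ 0 ∧ x ∈ ℬ i}

/-- The grading of the residue field `B ⧸ B₊`, concentrated in degree `0`. -/
def residueGrading (K B : Type) [Field K] [CommRing B] [Algebra K B] {ι : Type}
    [AddCommGroup ι] [DecidableEq ι] (ℬ : ι → Submodule K B) :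
    ι → Submodule K (B ⧸ irrelevant ℬ) :=
  fun i => if i = 0 then ⊤ else ⊥

/-- A positively `ℤ`-graded `K`-algebra is Koszul if the residue field has a linear
graded free resolution. -/
def IsKoszul (K B : Type) [Field K] [CommRing B] [Algebra K B]
    (ℬ : ℤ → Submodule K B) : Prop :=
  Nonempty (GradedFreeResolution K B ℬ (B ⧸ irrelevant ℬ) (residueGrading K B ℬ)
    (fun s => {(s : ℤ)}))

/-- A (positively) bigraded `K`-algebra is Koszul if the residue field has a free
resolution which is linear in the total degree. -/
def IsKoszulBi (K B : Type) [Field K] [CommRing B] [Algebra K B]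
    (ℬ : ℤ × ℤ → Submodule K B) : Prop :=
  Nonempty (GradedFreeResolution K B ℬ (B ⧸ irrelevant ℬ) (residueGrading K B ℬ)
    (fun s => {v : ℤ × ℤ | v.1 + v.2 = (s : ℤ)}))

/-- A bigraded algebra is standard if it is positively graded and generated by its
components of degrees `(1,0)` and `(0,1)` over the degree-`(0,0)` part `K`. -/
def IsStandardBigraded (K R : Type) [Field K] [CommRing R] [Algebra K R]
    (ℛ : ℤ × ℤ → Submodule K R) : Prop :=
  (∀ p : ℤ × ℤ, p.1 < 0 ∨ p.2 < 0 → ℛ p = ⊥) ∧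
  (ℛ (0, 0) = 1) ∧
  (∀ p : ℤ × ℤ, 0 ≤ p.1 → 0 ≤ p.2 →
    ℛ p = ℛ (1, 0) ^ p.1.toNat * ℛ (0, 1) ^ p.2.toNat)

open MvPolynomial

attribute [local instance] MvPolynomial.gradedAlgebra

/-- The standard `ℤ`-grading of the polynomial ring `K[x_1, …, x_n]`. -/
noncomputable def polyGrading (K : Type) [Field K] (n : ℕ) (k : ℤ) :
    Submodule K (MvPolynomial (Fin n) K) :=
  if 0 ≤ k then
    (homogeneousSubmodule (Fin n) K k.toNat : Submodule K (MvPolynomial (Fin n) K))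
  else ⊥

/-- The graded components of an ideal `I`, viewed as a graded module. -/
def idealGrading {K R : Type} [Field K] [CommRing R] [Algebra K R]
    (ℛ : ℤ → Submodule K R) (I : Ideal R) (k : ℤ) : Submodule K ↥I where
  carrier := {x | (x : R) ∈ ℛ k}
  add_mem' := fun {x y} hx hy => by simpa using add_mem hx hy
  zero_mem' := by simp
  smul_mem' := fun c x hx => by simpa using Submodule.smul_mem (ℛ k) c hx

/-- Total degree of an exponent vector. -/
def expDeg {τ : Type} (u : τ →₀ ℕ) : ℕ := u.sum fun _ e => e

/-- The degree reverse lexicographic order induced by `x_1 > x_2 > ⋯ > x_n`: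
`u` is smaller than `v` iff `u` has smaller total degree, or the total degrees
agree and the last variable in which `u` and `v` differ has a bigger exponent
in `u`. -/
def RevLexLt (n : ℕ) (u v : Fin n →₀ ℕ) : Prop :=
  expDeg u < expDeg v ∨
    (expDeg u = expDeg v ∧ ∃ i, v i < u i ∧ ∀ j, i < j → u j = v j)

/-- `u` is the exponent vector of the initial monomial `in(f)` of `f ≠ 0`. -/
def IsInitialMonomial {K : Type} [Field K] (n : ℕ)
    (f : MvPolynomial (Fin n) K) (u : Fin n →₀ ℕ) : Prop :=
  u ∈ f.support ∧ ∀ v ∈ f.support, v ≠ u → RevLexLt n v u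

/-- The initial ideal `in(I)` of an ideal `I`: the monomial ideal generated by the
initial monomials of the nonzero elements of `I`. -/
noncomputable def initialIdeal {K : Type} [Field K] (n : ℕ)
    (I : Ideal (MvPolynomial (Fin n) K)) : Ideal (MvPolynomial (Fin n) K) :=
  Ideal.span {m | ∃ f ∈ I, ∃ u, IsInitialMonomial n f u ∧ m = monomial u (1 : K)}

/-- The linear change of coordinates of `K[x_1, …, x_n]` given by a matrix `g`. -/
noncomputable def coordChange {K : Type} [Field K] (n : ℕ)
    (g : Matrix (Fin n) (Fin n) K) :
    MvPolynomial (Fin n) K →ₐ[K] MvPolynomial (Fin n) K :=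
  aeval fun i => ∑ j, g i j • X j

/-- `G` is the generic initial ideal `Gin(I)` of `I` with respect to the reverse
lexicographic order: for every invertible coordinate change `g` in a nonempty
Zariski-open subset of `GL_n(K)` (the nonvanishing locus of a nonzero polynomial
in the matrix entries), the initial ideal of `g · I` equals `G`. -/
def IsGin {K : Type} [Field K] (n : ℕ)
    (I G : Ideal (MvPolynomial (Fin n) K)) : Prop :=
  ∃ p : MvPolynomial (Fin n × Fin n) K, p ≠ 0 ∧
    ∀ g : Matrix (Fin n) (Fin n) K, IsUnit g.det →
      MvPolynomial.eval (fun ij => g ij.1 ij.2) p ≠ 0 →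
      initialIdeal n (Ideal.map (coordChange n g) I) = G

section FilterRegular

variable {R : Type*} [CommRing R] {M : ℕ → Type*} [∀ s, AddCommGroup (M s)]
  [∀ s, Module R (M s)] {δ : ∀ s, M (s + 1) →ₗ[R] M s} {n : ℕ} {y : ℕ → R} {L : ℕ → Ideal R}

theorem exists_eq_smul_add_of_mem_smul_top {N : Type*} [AddCommGroup N] [Module R N]
    {I J : Ideal R} {z : R} (h : I = J ⊔ Ideal.span {z}) {a : N}
    (ha : a ∈ I • (⊤ : Submodule R N)) :
    ∃ b, ∃ c ∈ J • (⊤ : Submodule R N), a = z • b + c := by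
  rw [h, Submodule.sup_smul, Submodule.ideal_span_singleton_smul, Submodule.mem_sup] at ha
  obtain ⟨c, hc, w, hw, rfl⟩ := ha
  obtain ⟨b, -, rfl⟩ := Submodule.mem_smul_pointwise_iff_exists _ _ _ |>.1 hw
  exact ⟨b, c, hc, add_comm _ _⟩

theorem map_mem_smul_top {N N' : Type*} [AddCommGroup N] [Module R N] [AddCommGroup N']
    [Module R N'] (f : N →ₗ[R] N') {I : Ideal R} {a : N} (ha : a ∈ I • (⊤ : Submodule R N)) :
    f a ∈ I • (⊤ : Submodule R N') := by
  have := Submodule.mem_map_of_mem (f := f) ha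
  rw [Submodule.map_smul''] at this
  exact Submodule.smul_mono le_rfl le_top this

/-- Cycles modulo `L k` of an exact complex are killed, modulo boundaries, by powers of the
`y l`, provided this holds for the annihilators of the `y k` in degree zero. -/
theorem exists_pow_smul_mem_of_cycle
    (hLn : L n = ⊥) (hL : ∀ k < n, L k = L (k + 1) ⊔ Ideal.span {y k})
    (hreg : ∀ k < n, ∀ s, ∀ a : M s, y k • a ∈ L (k + 1) • (⊤ : Submodule R (M s)) →
      a ∈ L (k + 1) • (⊤ : Submodule R (M s)))
    (hex : ∀ s, LinearMap.range (δ (s + 1)) = LinearMap.ker (δ s))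
    (htors : ∀ k < n, ∀ a : M 0,
      y k • a ∈ L (k + 1) • (⊤ : Submodule R (M 0)) ⊔ LinearMap.range (δ 0) →
      ∀ l < n, ∃ N : ℕ, y l ^ N • a ∈ L (k + 1) • (⊤ : Submodule R (M 0)) ⊔ LinearMap.range (δ 0))
    (k : ℕ) (hk : k ≤ n) (s : ℕ) (a : M (s + 1)) (ha : δ s a ∈ L k • (⊤ : Submodule R (M s)))
    (l : ℕ) (hl : l < n) :
    ∃ N : ℕ, y l ^ N • a ∈
      L k • (⊤ : Submodule R (M (s + 1))) ⊔ LinearMap.range (δ (s + 1)) := by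
  induction hk using Nat.decreasingInduction generalizing s a with
  | self =>
    refine ⟨0, Submodule.mem_sup_right ?_⟩
    rw [hLn, Submodule.bot_smul, Submodule.mem_bot] at ha
    rw [hex, pow_zero, one_smul]
    exact ha
  | of_succ k hk ih =>
    obtain ⟨b, c, hc, hab⟩ := exists_eq_smul_add_of_mem_smul_top (hL k hk) ha
    have key : ∃ N : ℕ, y l ^ N • b ∈
        L (k + 1) • (⊤ : Submodule R (M s)) ⊔ LinearMap.range (δ s) := by
      cases s with
      | zero =>
        refine htors k hk b ?_ l hl
        rw [← sub_eq_iff_eq_add.2 hab]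
        exact sub_mem (Submodule.mem_sup_right ⟨a, rfl⟩) (Submodule.mem_sup_left hc)
      | succ s =>
        refine ih s b (hreg k hk s _ ?_)
        have h0 : δ s (δ (s + 1) a) = 0 :=
          LinearMap.mem_ker.1 (hex s ▸ LinearMap.mem_range_self (δ (s + 1)) a)
        rw [hab, map_add, map_smul] at h0
        rw [eq_neg_of_add_eq_zero_left h0]
        exact neg_mem (map_mem_smul_top _ hc)
    obtain ⟨N, hN⟩ := key
    obtain ⟨c', hc', _, ⟨c'', rfl⟩, hb⟩ := Submodule.mem_sup.1 hN
    obtain ⟨N', hN'⟩ := ih s (y l ^ N • a - y k • c'') (by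
      have : δ s (y l ^ N • a - y k • c'') = y k • c' + y l ^ N • c := by
        rw [map_sub, map_smul, map_smul, hab, smul_add, smul_comm, ← hb, smul_add]
        abel
      rw [this]
      exact add_mem (Submodule.smul_mem _ _ hc') (Submodule.smul_mem _ _ hc))
    refine ⟨N' + N, ?_⟩
    have hle : L (k + 1) • (⊤ : Submodule R (M (s + 1))) ⊔ LinearMap.range (δ (s + 1)) ≤
        L k • (⊤ : Submodule R (M (s + 1))) ⊔ LinearMap.range (δ (s + 1)) :=
      sup_le_sup_right (Submodule.smul_mono_left (by rw [hL k hk]; exact le_sup_left)) _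
    have hyk : y k ∈ L k := by
      rw [hL k hk]
      exact Ideal.mem_sup_right (Ideal.mem_span_singleton_self _)
    have : y l ^ (N' + N) • a =
        y l ^ N' • (y l ^ N • a - y k • c'') + y k • y l ^ N' • c'' := by
      rw [smul_sub, smul_smul, pow_add, smul_comm (y k)]
      abel
    rw [this]
    exact add_mem (hle hN')
      (Submodule.mem_sup_left (Submodule.smul_mem_smul hyk Submodule.mem_top))

/-- If the sequence `y` generates the ideal `L 0` and is filter regular on the cokernel of
`δ 0`, then the annihilator of `y k` vanishes on `plus 0`, as soon as this can be read off
from a resolution with `plus (s + 1) ⊆ L 0 • ⊤`. -/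
theorem mem_of_smul_mem_of_linear (plus : ∀ s, Submodule R (M s))
    (hLn : L n = ⊥) (hL : ∀ k < n, L k = L (k + 1) ⊔ Ideal.span {y k})
    (hreg : ∀ k < n, ∀ s, ∀ a : M s, y k • a ∈ L (k + 1) • (⊤ : Submodule R (M s)) →
      a ∈ L (k + 1) • (⊤ : Submodule R (M s)))
    (hex : ∀ s, LinearMap.range (δ (s + 1)) = LinearMap.ker (δ s))
    (htors : ∀ k < n, ∀ a : M 0,
      y k • a ∈ L (k + 1) • (⊤ : Submodule R (M 0)) ⊔ LinearMap.range (δ 0) →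
      ∀ l < n, ∃ N : ℕ, y l ^ N • a ∈ L (k + 1) • (⊤ : Submodule R (M 0)) ⊔ LinearMap.range (δ 0))
    (hplus : ∀ s, plus (s + 1) ≤ L 0 • (⊤ : Submodule R (M (s + 1))))
    (hlift : ∀ k < n, ∀ s, ∀ a ∈ plus s, ∀ b,
      y k • a - δ s b ∈ L (k + 1) • (⊤ : Submodule R (M s)) →
      ∃ b' ∈ plus (s + 1), y k • a - δ s b' ∈ L (k + 1) • (⊤ : Submodule R (M s)))
    (k : ℕ) (hk : k < n) (a : M 0) (ha : a ∈ plus 0)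
    (hya : y k • a ∈ L (k + 1) • (⊤ : Submodule R (M 0)) ⊔ LinearMap.range (δ 0)) :
    a ∈ L (k + 1) • (⊤ : Submodule R (M 0)) ⊔ LinearMap.range (δ 0) := by
  have step : ∀ k < n, (∀ s, ∀ b ∈ plus (s + 1), δ s b ∈ L k • (⊤ : Submodule R (M s)) →
      b ∈ L k • (⊤ : Submodule R (M (s + 1))) ⊔ LinearMap.range (δ (s + 1))) →
      ∀ s, ∀ a ∈ plus s,
      y k • a ∈ L (k + 1) • (⊤ : Submodule R (M s)) ⊔ LinearMap.range (δ s) →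
      a ∈ L (k + 1) • (⊤ : Submodule R (M s)) ⊔ LinearMap.range (δ s) := by
    intro k hk hP s a ha hya
    obtain ⟨c, hc, _, ⟨b₀, rfl⟩, hcb⟩ := Submodule.mem_sup.1 hya
    obtain ⟨b, hb, hab⟩ := hlift k hk s a ha b₀ (by rw [← hcb]; simpa using hc)
    have hle : L (k + 1) ≤ L k := by rw [hL k hk]; exact le_sup_left
    have hyk : y k ∈ L k := by
      rw [hL k hk]
      exact Ideal.mem_sup_right (Ideal.mem_span_singleton_self _)
    have hδb : δ s b ∈ L k • (⊤ : Submodule R (M s)) := by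
      have := sub_mem (Submodule.smul_mem_smul hyk (Submodule.mem_top (x := a)))
        (Submodule.smul_mono_left hle hab)
      rwa [sub_sub_cancel] at this
    obtain ⟨w, hw, _, ⟨v, rfl⟩, rfl⟩ := Submodule.mem_sup.1 (hP s b hb hδb)
    obtain ⟨b', c', hc', rfl⟩ := exists_eq_smul_add_of_mem_smul_top (hL k hk) hw
    have h0 : δ s (δ (s + 1) v) = 0 :=
      LinearMap.mem_ker.1 (hex s ▸ LinearMap.mem_range_self (δ (s + 1)) v)
    have hmem : a - δ s b' ∈ L (k + 1) • (⊤ : Submodule R (M s)) := by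
      refine hreg k hk s _ ?_
      have := add_mem hab (map_mem_smul_top (δ s) hc')
      convert this using 1
      simp only [map_add, h0, map_smul, smul_sub]
      abel
    rw [← sub_add_cancel a (δ s b')]
    exact add_mem (Submodule.mem_sup_left hmem) (Submodule.mem_sup_right ⟨_, rfl⟩)
  have hP : ∀ k ≤ n, ∀ s, ∀ b ∈ plus (s + 1), δ s b ∈ L k • (⊤ : Submodule R (M s)) →
      b ∈ L k • (⊤ : Submodule R (M (s + 1))) ⊔ LinearMap.range (δ (s + 1)) := by
    intro k
    induction k with
    | zero => exact fun _ s b hb _ => Submodule.mem_sup_left (hplus s hb)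
    | succ k ih =>
      intro hk s b hb hδ
      obtain ⟨N, hN⟩ := exists_pow_smul_mem_of_cycle hLn hL hreg hex htors (k + 1) hk s b hδ k hk
      induction N with
      | zero => simpa using hN
      | succ N ihN =>
        refine ihN (step k hk (ih (by omega)) (s + 1) _ (Submodule.smul_mem _ _ hb) ?_)
        rwa [smul_smul, ← pow_succ']
  exact step k hk (hP k hk.le) 0 a ha hya

end FilterRegular

theorem expDeg_eq_degree {τ : Type} (u : τ →₀ ℕ) : expDeg u = u.degree := rfl

section RevLex

variable {n : ℕ}

theorem RevLexLt.irrefl (u : Fin n →₀ ℕ) : ¬ RevLexLt n u u := by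
  rintro (h | ⟨-, i, h, -⟩) <;> exact lt_irrefl _ h

theorem RevLexLt.trans {u v w : Fin n →₀ ℕ} (huv : RevLexLt n u v) (hvw : RevLexLt n v w) :
    RevLexLt n u w := by
  rcases huv with h | ⟨h, i, hi, hi'⟩ <;> rcases hvw with h' | ⟨h', j, hj, hj'⟩
  · exact Or.inl (h.trans h')
  · exact Or.inl (h' ▸ h)
  · exact Or.inl (h ▸ h')
  · refine Or.inr ⟨h.trans h', ?_⟩
    rcases lt_trichotomy i j with hij | rfl | hij
    · exact ⟨j, by rwa [hi' j hij], fun k hk => (hi' k (hij.trans hk)).trans (hj' k hk)⟩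
    · exact ⟨i, hj.trans hi, fun k hk => (hi' k hk).trans (hj' k hk)⟩
    · exact ⟨i, by rwa [← hj' i hij], fun k hk => (hi' k hk).trans (hj' k (hij.trans hk))⟩

theorem RevLexLt.total (u v : Fin n →₀ ℕ) : RevLexLt n u v ∨ u = v ∨ RevLexLt n v u := by
  rcases lt_trichotomy (expDeg u) (expDeg v) with h | h | h
  · exact Or.inl (Or.inl h)
  · by_cases huv : u = v
    · exact Or.inr (Or.inl huv)
    · obtain ⟨i₀, hi₀⟩ : ∃ i, u i ≠ v i := by
        by_contra! hne
        exact huv (Finsupp.ext hne)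
      obtain ⟨i, hi, hmax⟩ := (Finset.univ.filter fun i => u i ≠ v i).exists_maximal
        ⟨i₀, by simpa using hi₀⟩
      have heq : ∀ j, i < j → u j = v j := fun j hij => by
        by_contra hj
        exact absurd (hmax (y := j) (by simpa using hj) hij.le) (not_le.2 hij)
      rcases lt_or_gt_of_ne (show u i ≠ v i by simpa using hi) with hlt | hlt
      · exact Or.inr (Or.inr (Or.inr ⟨h.symm, i, hlt, fun j hj => (heq j hj).symm⟩))
      · exact Or.inl (Or.inr ⟨h, i, hlt, heq⟩)
  · exact Or.inr (Or.inr (Or.inl h))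

theorem RevLexLt.asymm {u v : Fin n →₀ ℕ} (huv : RevLexLt n u v) : ¬ RevLexLt n v u :=
  fun h => RevLexLt.irrefl u (huv.trans h)

theorem RevLexLt.add_right_iff {u v w : Fin n →₀ ℕ} :
    RevLexLt n (u + w) (v + w) ↔ RevLexLt n u v := by
  simp only [RevLexLt, expDeg_eq_degree, map_add, Finsupp.add_apply, add_lt_add_iff_right,
    add_left_inj]

theorem RevLexLt.exists_max (s : Finset (Fin n →₀ ℕ)) (hs : s.Nonempty) :
    ∃ u ∈ s, ∀ v ∈ s, v ≠ u → RevLexLt n v u := by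
  induction hs using Finset.Nonempty.cons_induction with
  | singleton a => exact ⟨a, by simp, fun v hv hne => absurd (by simpa using hv) hne⟩
  | cons a s ha hs ih =>
    obtain ⟨u, hu, hmax⟩ := ih
    rcases RevLexLt.total u a with h | rfl | h
    · refine ⟨a, by simp, fun v hv hne => ?_⟩
      rcases eq_or_ne v u with rfl | hvu
      · exact h
      · exact (hmax v ((Finset.mem_cons.1 hv).resolve_left hne) hvu).trans h
    · exact absurd hu ha
    · refine ⟨u, by simp [hu], fun v hv hne => ?_⟩
      rcases Finset.mem_cons.1 hv with rfl | hv
      · exact h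
      · exact hmax v hv hne

end RevLex

section InitialIdeal

variable {K : Type} [Field K] {n : ℕ}

theorem exists_isInitialMonomial {f : MvPolynomial (Fin n) K} (hf : f ≠ 0) :
    ∃ u, IsInitialMonomial n f u :=
  RevLexLt.exists_max f.support (MvPolynomial.support_nonempty.2 hf)

theorem IsInitialMonomial.monomial_mul {f : MvPolynomial (Fin n) K} {u : Fin n →₀ ℕ}
    (h : IsInitialMonomial n f u) (w : Fin n →₀ ℕ) :
    IsInitialMonomial n (monomial w 1 * f) (u + w) := by
  refine ⟨?_, fun v hv hne => ?_⟩
  · rw [mem_support_iff, add_comm, coeff_monomial_mul, one_mul]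
    exact mem_support_iff.1 h.1
  · rw [mem_support_iff, coeff_monomial_mul'] at hv
    split_ifs at hv with hle
    · have := (h.2 (v - w) (by simpa [mem_support_iff] using hv) (by
        rintro rfl
        exact hne (tsub_add_cancel_of_le hle).symm))
      rwa [← RevLexLt.add_right_iff (w := w), tsub_add_cancel_of_le hle] at this
    · exact absurd rfl hv

theorem monomial_mem_initialIdeal {I : Ideal (MvPolynomial (Fin n) K)} {u : Fin n →₀ ℕ} :
    monomial u (1 : K) ∈ initialIdeal n I ↔ ∃ f ∈ I, IsInitialMonomial n f u := by
  refine ⟨fun h => ?_, fun ⟨f, hf, hu⟩ => Ideal.subset_span ⟨f, hf, u, hu, rfl⟩⟩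
  have heq : initialIdeal n I = Ideal.span
      ((fun s => monomial s (1 : K)) '' {u | ∃ f ∈ I, IsInitialMonomial n f u}) := by
    unfold initialIdeal
    congr 1
    ext m
    constructor
    · rintro ⟨f, hf, u, hu, rfl⟩
      exact ⟨u, ⟨f, hf, hu⟩, rfl⟩
    · rintro ⟨u, ⟨f, hf, hu⟩, rfl⟩
      exact ⟨f, hf, u, hu, rfl⟩
  rw [heq, mem_ideal_span_monomial_image] at h
  obtain ⟨v, ⟨f, hf, hv⟩, hle⟩ := h u (by simp)
  refine ⟨monomial (u - v) 1 * f, I.mul_mem_left _ hf, ?_⟩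
  have := hv.monomial_mul (u - v)
  rwa [add_tsub_cancel_of_le hle] at this

theorem IsInitialMonomial.homogeneousComponent {f : MvPolynomial (Fin n) K} {u : Fin n →₀ ℕ}
    (h : IsInitialMonomial n f u) :
    IsInitialMonomial n (MvPolynomial.homogeneousComponent u.degree f) u := by
  refine ⟨?_, fun v hv hne => h.2 v ?_ hne⟩
  · rw [mem_support_iff, coeff_homogeneousComponent, if_pos rfl]
    exact mem_support_iff.1 h.1
  · rw [mem_support_iff, coeff_homogeneousComponent] at hv
    rw [mem_support_iff]
    exact fun h0 => hv (by simp [h0])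

/-- Monomials of the initial ideal of a homogeneous ideal are initial monomials of
homogeneous elements. -/
theorem exists_isHomogeneous_of_monomial_mem {I : Ideal (MvPolynomial (Fin n) K)}
    (hI : I.IsHomogeneous (homogeneousSubmodule (Fin n) K)) {u : Fin n →₀ ℕ}
    (hu : monomial u (1 : K) ∈ initialIdeal n I) :
    ∃ f ∈ I, f.IsHomogeneous u.degree ∧ IsInitialMonomial n f u := by
  obtain ⟨f, hf, hfu⟩ := monomial_mem_initialIdeal.1 hu
  exact ⟨_, homogeneousComponent_mem_of_mem hI hf _, homogeneousComponent_isHomogeneous _ _,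
    hfu.homogeneousComponent⟩

end InitialIdeal

section TailIdeal

variable (K : Type) [Field K] (n : ℕ)

/-- The ideal generated by the variables with index at least `k`. -/
noncomputable def tailIdeal (k : ℕ) : Ideal (MvPolynomial (Fin n) K) :=
  Ideal.span (X '' {l : Fin n | k ≤ l})

variable {K n}

theorem mem_tailIdeal {k : ℕ} {f : MvPolynomial (Fin n) K} :
    f ∈ tailIdeal K n k ↔ ∀ u ∈ f.support, ∃ l : Fin n, k ≤ l ∧ u l ≠ 0 :=
  mem_ideal_span_X_image

theorem isHomogeneous_tailIdeal (k : ℕ) :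
    (tailIdeal K n k).IsHomogeneous (homogeneousSubmodule (Fin n) K) := by
  refine Ideal.homogeneous_span _ _ ?_
  rintro _ ⟨l, -, rfl⟩
  exact ⟨1, isHomogeneous_X K l⟩

theorem tailIdeal_eq_sup (k : Fin n) :
    tailIdeal K n k = tailIdeal K n (k + 1) ⊔ Ideal.span {X k} := by
  rw [tailIdeal, tailIdeal, ← Ideal.span_union, ← Set.image_singleton, ← Set.image_union]
  congr 2
  ext l
  simp only [Set.mem_ofPred_eq, Set.mem_union, Set.mem_singleton_iff, Fin.ext_iff]
  omega

theorem homogeneousComponent_add_mul_of_isHomogeneous {σ : Type*} {t e : ℕ}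
    (a : MvPolynomial σ K) {b : MvPolynomial σ K} (hb : b.IsHomogeneous e) :
    homogeneousComponent (t + e) (a * b) = homogeneousComponent t a * b := by
  have := DirectSum.coe_decompose_mul_add_of_right_mem (homogeneousSubmodule σ K)
    (a := a) (b := b) (i := t) (j := e) hb
  rw [← decomposition.decompose'_apply, ← decomposition.decompose'_apply]
  exact this

/-- If multiplication by the variable `X k` is injective in degrees at least two modulo the
homogeneous ideal `I` and the variables after `X k`, then a monomial of degree at least three
in the reverse lexicographic initial ideal of `I` is not a minimal generator. -/
theorem exists_monomial_sub_single_mem_initialIdeal {I : Ideal (MvPolynomial (Fin n) K)}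
    (hI : I.IsHomogeneous (homogeneousSubmodule (Fin n) K))
    (hcolon : ∀ k : Fin n, ∀ d, 2 ≤ d → ∀ f : MvPolynomial (Fin n) K, f.IsHomogeneous d →
      X k * f ∈ I ⊔ tailIdeal K n (k + 1) → f ∈ I ⊔ tailIdeal K n (k + 1))
    {u : Fin n →₀ ℕ} (hdeg : 3 ≤ u.degree) (hu : monomial u (1 : K) ∈ initialIdeal n I) :
    ∃ k : Fin n, u k ≠ 0 ∧ monomial (u - Finsupp.single k 1) (1 : K) ∈ initialIdeal n I := by
  obtain ⟨f, hf, hfhom, hfu⟩ := exists_isHomogeneous_of_monomial_mem hI hu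
  obtain ⟨d, hd⟩ : ∃ d, u.degree = d + 1 := ⟨u.degree - 1, by omega⟩
  obtain ⟨k, hk, hkmax⟩ : ∃ k, u k ≠ 0 ∧ ∀ l, k < l → u l = 0 := by
    have hne : u.support.Nonempty := by
      rw [Finsupp.support_nonempty_iff]
      rintro rfl
      simp at hdeg
    obtain ⟨k, hk, hmax⟩ := u.support.exists_maximal hne
    refine ⟨k, by simpa using hk, fun l hl => ?_⟩
    by_contra h
    exact absurd (hmax (y := l) (by simpa using h) hl.le) (not_le.2 hl)
  refine ⟨k, hk, ?_⟩
  rw [hd] at hfhom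
  have hfT : f ∈ tailIdeal K n (k + 1) ⊔ Ideal.span {X k} := by
    rw [← tailIdeal_eq_sup, mem_tailIdeal]
    intro v hv
    rcases eq_or_ne v u with rfl | hvu
    · exact ⟨k, le_rfl, hk⟩
    · have hvd : v.degree = u.degree := by
        rw [hd]
        by_contra h
        exact mem_support_iff.1 hv (hfhom.coeff_eq_zero h)
      rcases hfu.2 v hv hvu with h | ⟨-, i, hi, heq⟩
      · exact absurd hvd h.ne
      · rcases lt_or_ge i k with hik | hik
        · exact ⟨k, le_rfl, heq k hik ▸ hk⟩
        · exact ⟨i, hik, by omega⟩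
  obtain ⟨r, hr, q, hqr⟩ : ∃ r ∈ tailIdeal K n (k + 1), ∃ q : MvPolynomial (Fin n) K,
      r + q * X k = f := by
    obtain ⟨r, hr, w, hw, hrw⟩ := Submodule.mem_sup.1 hfT
    obtain ⟨q, rfl⟩ := Ideal.mem_span_singleton'.1 hw
    exact ⟨r, hr, q, hrw⟩
  replace hqr : homogeneousComponent (d + 1) r + homogeneousComponent d q * X k = f := by
    rw [← homogeneousComponent_add_mul_of_isHomogeneous q (isHomogeneous_X K k), ← map_add, hqr,
      homogeneousComponent_eq_self hfhom]
  replace hr := homogeneousComponent_mem_of_mem (isHomogeneous_tailIdeal _) hr (d + 1)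
  have hqhom : (homogeneousComponent d q).IsHomogeneous d :=
    homogeneousComponent_isHomogeneous d q
  generalize homogeneousComponent (d + 1) r = r at hqr hr
  generalize homogeneousComponent d q = q at hqr hqhom
  have hq : q ∈ I ⊔ tailIdeal K n (k + 1) := by
    refine hcolon k d (by omega) q hqhom ?_
    rw [mul_comm, eq_sub_of_add_eq' hqr]
    exact sub_mem (Ideal.mem_sup_left hf) (Ideal.mem_sup_right hr)
  obtain ⟨h, hh, r', hr', hsum⟩ := Submodule.mem_sup.1 hq
  replace hsum : homogeneousComponent d h + homogeneousComponent d r' = q := by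
    rw [← map_add, hsum, homogeneousComponent_eq_self hqhom]
  replace hh := homogeneousComponent_mem_of_mem hI hh d
  replace hr' := homogeneousComponent_mem_of_mem (isHomogeneous_tailIdeal _) hr' d
  have hhhom : (homogeneousComponent d h).IsHomogeneous d :=
    homogeneousComponent_isHomogeneous d h
  generalize homogeneousComponent d h = h at hsum hh hhhom
  generalize homogeneousComponent d r' = r' at hsum hr'
  have hcoeff : ∀ v : Fin n →₀ ℕ, (∀ l, k < l → v l = 0) →
      coeff v h = coeff (v + Finsupp.single k 1) f := by
    have htail : ∀ g ∈ tailIdeal K n (k + 1), ∀ v : Fin n →₀ ℕ, (∀ l, k < l → v l = 0) →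
        coeff v g = 0 := by
      intro g hg v hv
      by_contra hne
      obtain ⟨l, hl, hvl⟩ := mem_tailIdeal.1 hg v (mem_support_iff.2 hne)
      exact hvl (hv l hl)
    intro v hv
    rw [← hqr, coeff_add, coeff_mul_X, ← hsum, coeff_add, htail r' hr' v hv,
      htail r hr _ (fun l hl => by
        rw [Finsupp.add_apply, hv l hl, Finsupp.single_eq_of_ne hl.ne', add_zero])]
    ring
  have hle : Finsupp.single k 1 ≤ u := by
    rw [Finsupp.single_le_iff]
    omega
  have htail' : ∀ l, k < l → (u - Finsupp.single k 1 : Fin n →₀ ℕ) l = 0 := fun l hl => by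
    rw [Finsupp.tsub_apply, hkmax l hl, zero_tsub]
  refine monomial_mem_initialIdeal.2 ⟨h, hh, ?_, fun v hv hne => ?_⟩
  · rw [mem_support_iff, hcoeff _ htail', tsub_add_cancel_of_le hle]
    exact mem_support_iff.1 hfu.1
  · by_cases hvk : ∀ l, k < l → v l = 0
    · rw [← RevLexLt.add_right_iff (w := Finsupp.single k 1), tsub_add_cancel_of_le hle]
      refine hfu.2 _ ?_ ?_
      · rw [mem_support_iff, ← hcoeff v hvk]
        exact mem_support_iff.1 hv
      · rintro rfl
        exact hne (add_tsub_cancel_right _ _).symm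
    · push Not at hvk
      obtain ⟨l, hl, hvl⟩ := hvk
      have hvd : v.degree = d := by
        by_contra h
        exact mem_support_iff.1 hv (hhhom.coeff_eq_zero h)
      have hud : (u - Finsupp.single k 1).degree = d := by
        have := congrArg Finsupp.degree (tsub_add_cancel_of_le hle)
        rw [map_add, Finsupp.degree_single, hd] at this
        omega
      refine (RevLexLt.total v (u - Finsupp.single k 1)).resolve_right ?_
      rintro (h | h | ⟨-, i, hi, heq⟩)
      · exact hne h
      · rw [expDeg_eq_degree, expDeg_eq_degree, hvd, hud] at h
        exact lt_irrefl _ h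
      · have hik : i ≤ k := by
          by_contra hlt
          rw [htail' i (not_le.1 hlt)] at hi
          exact absurd hi (Nat.not_lt_zero _)
        exact hvl ((heq l (hik.trans_lt hl)).symm.trans (htail' l hl))

/-- Under the hypotheses of `exists_monomial_sub_single_mem_initialIdeal`, if moreover `I` lives
in degrees at least two, then its initial ideal is generated by quadratic monomials. -/
theorem initialIdeal_eq_span_quadratic {I : Ideal (MvPolynomial (Fin n) K)}
    (hI : I.IsHomogeneous (homogeneousSubmodule (Fin n) K))
    (hlow : ∀ f ∈ I, ∀ d < 2, homogeneousComponent d f = 0)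
    (hcolon : ∀ k : Fin n, ∀ d, 2 ≤ d → ∀ f : MvPolynomial (Fin n) K, f.IsHomogeneous d →
      X k * f ∈ I ⊔ tailIdeal K n (k + 1) → f ∈ I ⊔ tailIdeal K n (k + 1)) :
    initialIdeal n I = Ideal.span {m | ∃ u : Fin n →₀ ℕ, expDeg u = 2 ∧
      monomial u (1 : K) ∈ initialIdeal n I ∧ m = monomial u (1 : K)} := by
  have key : ∀ d, ∀ u : Fin n →₀ ℕ, u.degree = d → monomial u (1 : K) ∈ initialIdeal n I →
      monomial u (1 : K) ∈ Ideal.span {m | ∃ u : Fin n →₀ ℕ, expDeg u = 2 ∧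
        monomial u (1 : K) ∈ initialIdeal n I ∧ m = monomial u (1 : K)} := by
    intro d
    induction d with
    | zero =>
      intro u hd hu
      obtain ⟨f, hf, hfhom, hfu⟩ := exists_isHomogeneous_of_monomial_mem hI hu
      have := hlow f hf u.degree (by omega)
      rw [homogeneousComponent_eq_self hfhom] at this
      exact absurd hfu.1 (by simp [this])
    | succ d ih =>
      intro u hd hu
      rcases lt_trichotomy (d + 1) 2 with h | h | h
      · obtain ⟨f, hf, hfhom, hfu⟩ := exists_isHomogeneous_of_monomial_mem hI hu
        have := hlow f hf u.degree (by omega)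
        rw [homogeneousComponent_eq_self hfhom] at this
        exact absurd hfu.1 (by simp [this])
      · exact Ideal.subset_span ⟨u, hd.trans h, hu, rfl⟩
      · obtain ⟨k, hk, hmem⟩ :=
          exists_monomial_sub_single_mem_initialIdeal hI hcolon (by omega) hu
        have hle : Finsupp.single k 1 ≤ u := by
          rw [Finsupp.single_le_iff]
          omega
        have hud := congrArg Finsupp.degree (tsub_add_cancel_of_le hle)
        rw [map_add, Finsupp.degree_single, hd] at hud
        have := Ideal.mul_mem_left _ (X k) (ih _ (by omega) hmem)
        rwa [X, monomial_mul, one_mul, add_tsub_cancel_of_le hle] at this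
  refine le_antisymm (Ideal.span_le.2 ?_) (Ideal.span_le.2 ?_)
  · rintro _ ⟨f, hf, u, hu, rfl⟩
    exact key _ u rfl (monomial_mem_initialIdeal.2 ⟨f, hf, hu⟩)
  · rintro _ ⟨u, -, hu, rfl⟩
    exact hu

end TailIdeal

section CoordChange

variable {K : Type} [Field K] {n : ℕ}

theorem coordChange_X (g : Matrix (Fin n) (Fin n) K) (i : Fin n) :
    coordChange n g (X i) = ∑ j, g i j • X j :=
  aeval_X _ _

theorem coordChange_comp (g h : Matrix (Fin n) (Fin n) K) :
    (coordChange n h).comp (coordChange n g) = coordChange n (g * h) := by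
  refine MvPolynomial.algHom_ext fun i => ?_
  simp only [AlgHom.comp_apply, coordChange_X, map_sum, map_smul, Matrix.mul_apply,
    Finset.sum_smul, Finset.smul_sum, smul_smul]
  exact Finset.sum_comm

theorem coordChange_one : coordChange n (1 : Matrix (Fin n) (Fin n) K) = AlgHom.id K _ := by
  refine MvPolynomial.algHom_ext fun i => ?_
  simp [coordChange_X, Matrix.one_apply, ite_smul]

theorem coordChange_mul_apply (g h : Matrix (Fin n) (Fin n) K) (f : MvPolynomial (Fin n) K) :
    coordChange n (g * h) f = coordChange n h (coordChange n g f) := by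
  rw [← coordChange_comp, AlgHom.comp_apply]

theorem isHomogeneous_sum_smul_X (v : Fin n → K) :
    (∑ j, v j • X j : MvPolynomial (Fin n) K).IsHomogeneous 1 :=
  IsHomogeneous.sum _ _ _ fun j _ => by
    rw [smul_eq_C_mul]
    exact isHomogeneous_C_mul_X _ _

theorem isHomogeneous_coordChange (g : Matrix (Fin n) (Fin n) K) {f : MvPolynomial (Fin n) K}
    {d : ℕ} (hf : f.IsHomogeneous d) : (coordChange n g f).IsHomogeneous d := by
  have := hf.aeval (fun i => ∑ j, g i j • X j) (n := 1)
    (fun i => isHomogeneous_sum_smul_X (g i))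
  rwa [one_mul] at this

theorem homogeneousComponent_coordChange (g : Matrix (Fin n) (Fin n) K)
    (f : MvPolynomial (Fin n) K) (d : ℕ) :
    homogeneousComponent d (coordChange n g f) = coordChange n g (homogeneousComponent d f) := by
  conv_lhs => rw [← sum_homogeneousComponent f]
  rw [map_sum, map_sum]
  simp_rw [homogeneousComponent_of_mem (isHomogeneous_coordChange g
    (homogeneousComponent_isHomogeneous _ f)), Finset.sum_ite_eq, Finset.mem_range]
  split_ifs with h
  · rfl
  · rw [homogeneousComponent_eq_zero _ _ (by omega), map_zero]

theorem coordChange_surjective {g : Matrix (Fin n) (Fin n) K} (hg : IsUnit g.det) :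
    Function.Surjective (coordChange n g) := fun f =>
  ⟨coordChange n g⁻¹ f, by
    rw [← coordChange_mul_apply, Matrix.nonsing_inv_mul _ hg, coordChange_one]
    rfl⟩

theorem coordChange_injective {g : Matrix (Fin n) (Fin n) K} (hg : IsUnit g.det) :
    Function.Injective (coordChange n g) :=
  Function.LeftInverse.injective (g := coordChange n g⁻¹) fun f => by
    rw [← coordChange_mul_apply, Matrix.mul_nonsing_inv _ hg, coordChange_one]
    rfl

theorem mem_map_coordChange {g : Matrix (Fin n) (Fin n) K} (hg : IsUnit g.det)
    {Q : Ideal (MvPolynomial (Fin n) K)} {f : MvPolynomial (Fin n) K} :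
    f ∈ Q.map (coordChange n g) ↔ ∃ q ∈ Q, coordChange n g q = f :=
  Ideal.mem_map_iff_of_surjective _ (coordChange_surjective hg)

theorem isHomogeneous_map_coordChange {g : Matrix (Fin n) (Fin n) K} (hg : IsUnit g.det)
    {Q : Ideal (MvPolynomial (Fin n) K)}
    (hQ : Q.IsHomogeneous (homogeneousSubmodule (Fin n) K)) :
    (Q.map (coordChange n g)).IsHomogeneous (homogeneousSubmodule (Fin n) K) := by
  intro d f hf
  obtain ⟨q, hq, rfl⟩ := (mem_map_coordChange hg).1 hf
  change (((DirectSum.Decomposition.decompose' (coordChange n g q)) d :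
    homogeneousSubmodule (Fin n) K d) : MvPolynomial (Fin n) K) ∈ _
  rw [decomposition.decompose'_apply, homogeneousComponent_coordChange]
  exact Ideal.mem_map_of_mem _ (homogeneousComponent_mem_of_mem hQ hq d)

theorem coordChange_transvection_X (j k : Fin n) (t : K) (a : Fin n) :
    coordChange n (Matrix.transvection j k t) (X a) = X a + if a = j then t • X k else 0 := by
  rw [coordChange_X]
  simp only [Matrix.transvection, Matrix.add_apply, Matrix.one_apply, Matrix.single_apply,
    add_smul, Finset.sum_add_distrib, ite_smul, one_smul, zero_smul, Finset.sum_ite_eq,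
    Finset.mem_univ, if_true]
  congr 1
  split_ifs with h
  · subst h
    simp
  · simp [Ne.symm h]

/-- The Taylor expansion of a quadratic form under a transvection. -/
theorem exists_coordChange_transvection_eq (j k : Fin n) {f : MvPolynomial (Fin n) K}
    (hf : f.IsHomogeneous 2) :
    ∃ B : MvPolynomial (Fin n) K, ∀ t : K, coordChange n (Matrix.transvection j k t) f =
      f + t • (X k * pderiv j f) + t ^ 2 • B := by
  have hmem : f ∈ (homogeneousSubmodule (Fin n) K 1) ^ 2 := by
    rwa [homogeneousSubmodule_one_pow]
  have hlin : ∀ g ∈ homogeneousSubmodule (Fin n) K 1, ∀ t : K,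
      coordChange n (Matrix.transvection j k t) g = g + t • (X k * pderiv j g) := by
    intro g hg t
    rw [homogeneousSubmodule_one_eq_span_X] at hg
    induction hg using Submodule.span_induction with
    | mem g hg =>
      obtain ⟨a, rfl⟩ := hg
      rw [coordChange_transvection_X, pderiv_X]
      by_cases h : a = j <;> simp [h]
    | zero => simp
    | add g g' _ _ hg hg' =>
      rw [map_add, hg, hg', map_add, mul_add, smul_add]
      ring
    | smul c g _ hg =>
      rw [map_smul, hg, Derivation.map_smul, mul_smul_comm, smul_add, smul_comm c t]
  rw [pow_two] at hmem
  clear hf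
  induction hmem using Submodule.mul_induction_on' with
  | mem_mul_mem g hg h hh =>
    refine ⟨(X k * pderiv j g) * (X k * pderiv j h), fun t => ?_⟩
    rw [map_mul, hlin g hg, hlin h hh, pderiv_mul]
    simp only [smul_eq_C_mul, C_pow]
    ring
  | add g _ h _ hg hh =>
    obtain ⟨B, hB⟩ := hg
    obtain ⟨B', hB'⟩ := hh
    refine ⟨B + B', fun t => ?_⟩
    rw [map_add, hB, hB', map_add, mul_add, smul_add, smul_add]
    ring

end CoordChange

section Borel

variable {K : Type} [Field K] {n : ℕ}

theorem det_coeff_ne_zero_of_triangular {W : Finset (Fin n →₀ ℕ)}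
    (H : W → MvPolynomial (Fin n) K) (hdiag : ∀ w, coeff w.1 (H w) ≠ 0)
    (hupper : ∀ w w' : W, RevLexLt n w.1 w'.1 → coeff w'.1 (H w) = 0) :
    (Matrix.of fun w w' : W => coeff w'.1 (H w)).det ≠ 0 := by
  classical
  intro hdet
  obtain ⟨x, hx, hx0⟩ := Matrix.exists_vecMul_eq_zero_iff.2 hdet
  obtain ⟨w, hw, hmax⟩ := RevLexLt.exists_max
    ((Finset.univ.filter fun w : W => x w ≠ 0).map (Function.Embedding.subtype _)) (by
      obtain ⟨w, hw⟩ := Function.ne_iff.1 hx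
      exact ⟨w, by simpa using hw⟩)
  simp only [Finset.mem_map, Finset.mem_filter, Finset.mem_univ, true_and,
    Function.Embedding.subtype_apply] at hw hmax
  obtain ⟨w, hxw, rfl⟩ := hw
  have h := congrFun hx0 w
  rw [Matrix.vecMul, dotProduct, Finset.sum_eq_single w] at h
  · exact mul_ne_zero hxw (hdiag w) h
  · intro w' _ hne
    by_cases hx' : x w' = 0
    · rw [hx', zero_mul]
    · rw [Matrix.of_apply, hupper w' w (hmax _ ⟨w', hx', rfl⟩ fun h => hne (Subtype.ext h)),
        mul_zero]
  · simp

theorem coeff_X_mul_pderiv_self {i j k : Fin n} {f : MvPolynomial (Fin n) K} :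
    coeff (Finsupp.single i 1 + Finsupp.single k 1) (X k * pderiv j f) =
      coeff (Finsupp.single i 1 + Finsupp.single j 1) f *
        ((Finsupp.single i 1 : Fin n →₀ ℕ) j + 1) := by
  rw [coeff_X_mul', if_pos (by simp), add_tsub_cancel_right, coeff_pderiv]

/-- The main step in the proof that quadratic parts of generic initial ideals are stable. -/
theorem monomial_mem_of_forall_transvection (hchar : (2 : K) ≠ 0) [Infinite K]
    {I G : Ideal (MvPolynomial (Fin n) K)}
    (hI : I.IsHomogeneous (homogeneousSubmodule (Fin n) K)) (hIG : initialIdeal n I = G)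
    {j k : Fin n} (hkj : k < j) {p : Polynomial K} (hp : p ≠ 0)
    (hG : ∀ t, p.eval t ≠ 0 →
      initialIdeal n (I.map (coordChange n (Matrix.transvection j k t))) = G)
    (i : Fin n) (hm : monomial (Finsupp.single i 1 + Finsupp.single j 1) (1 : K) ∈ G) :
    monomial (Finsupp.single i 1 + Finsupp.single k 1) (1 : K) ∈ G := by
  classical
  by_contra hv
  generalize hmdef : (Finsupp.single i 1 + Finsupp.single j 1 : Fin n →₀ ℕ) = m at hm
  generalize hvdef : (Finsupp.single i 1 + Finsupp.single k 1 : Fin n →₀ ℕ) = v at hv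
  have hmdeg : m.degree = 2 := by simp [← hmdef]
  have hvdeg : v.degree = 2 := by simp [← hvdef]
  have hmv : RevLexLt n m v := by
    rw [← hmdef, ← hvdef, add_comm, add_comm _ (Finsupp.single k 1), RevLexLt.add_right_iff]
    refine Or.inr ⟨by simp [expDeg_eq_degree], j, ?_, fun l hl => ?_⟩
    · simp [Finsupp.single_eq_of_ne hkj.ne']
    · rw [Finsupp.single_eq_of_ne hl.ne', Finsupp.single_eq_of_ne (hkj.trans hl).ne']
  have hfin : {w : Fin n →₀ ℕ | w = v ∨ (w.degree = 2 ∧ RevLexLt n v w ∧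
      monomial w (1 : K) ∈ G)}.Finite := by
    refine (Finsupp.finite_of_degree_eq (σ := Fin n) 2).subset ?_
    rintro w (rfl | ⟨h, -⟩)
    · exact hvdeg
    · exact h
  obtain ⟨W, hW⟩ := hfin.exists_finset
  simp only [Set.mem_ofPred_eq] at hW
  have hF : ∀ w : W, ∃ f ∈ I, f.IsHomogeneous 2 ∧
      IsInitialMonomial n f (if w.1 = v then m else w.1) := by
    intro w
    split_ifs with h
    · rw [← hIG] at hm
      have := exists_isHomogeneous_of_monomial_mem hI hm
      rwa [hmdeg] at this
    · obtain ⟨hd, -, hw⟩ := ((hW _).1 w.2).resolve_left h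
      rw [← hIG] at hw
      have := exists_isHomogeneous_of_monomial_mem hI hw
      rwa [hd] at this
  choose F hFI hFhom hFin using hF
  choose B hB using fun w => exists_coordChange_transvection_eq j k (hFhom w)
  have hwv : ∀ w : W, w.1 ≠ v → RevLexLt n v w.1 := fun w h =>
    (((hW _).1 w.2).resolve_left h).2.1
  have hvF : ∀ w w' : W, w.1 = v → coeff w'.1 (F w) = 0 := by
    intro w w' hw
    have h := (hFin w).2 w'.1
    rw [if_pos hw] at h
    have hmw' : RevLexLt n m w'.1 := by
      by_cases h' : w'.1 = v
      · rwa [h']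
      · exact hmv.trans (hwv w' h')
    by_contra hne
    refine (h (mem_support_iff.2 hne) ?_).asymm hmw'
    intro h'
    rw [h'] at hmw'
    exact hmw'.irrefl
  set A : W → MvPolynomial (Fin n) K := fun w => X k * pderiv j (F w) with hA
  set H₀ : W → MvPolynomial (Fin n) K := fun w => if w.1 = v then A w else F w with hH₀
  set H₁ : W → MvPolynomial (Fin n) K := fun w => if w.1 = v then B w else A w with hH₁
  set H₂ : W → MvPolynomial (Fin n) K := fun w => if w.1 = v then 0 else B w with hH₂
  set D : Matrix W W (Polynomial K) := Matrix.of fun w w' =>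
    Polynomial.C (coeff w'.1 (H₀ w)) + Polynomial.X * Polynomial.C (coeff w'.1 (H₁ w)) +
      Polynomial.X ^ 2 * Polynomial.C (coeff w'.1 (H₂ w)) with hD
  have hDeval : ∀ t, D.det.eval t =
      (Matrix.of fun w w' : W => coeff w'.1 (H₀ w + t • H₁ w + t ^ 2 • H₂ w)).det := by
    intro t
    rw [← Polynomial.coe_evalRingHom, RingHom.map_det]
    congr 1
    ext w w'
    simp [hD]
    ring
  have hDne : D.det ≠ 0 := by
    intro h0
    have h := hDeval 0
    rw [h0, Polynomial.eval_zero] at h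
    refine det_coeff_ne_zero_of_triangular _ ?_ ?_ h.symm
    · intro w
      by_cases hw : w.1 = v
      · have h2 : ((Finsupp.single i 1 : Fin n →₀ ℕ) j + 1 : K) ≠ 0 := by
          rcases eq_or_ne j i with rfl | hji
          · simpa [one_add_one_eq_two] using hchar
          · simp [Finsupp.single_eq_of_ne hji]
        have hcoeff := (hFin w).1
        rw [if_pos hw, mem_support_iff, ← hmdef] at hcoeff
        simp only [hH₀, if_pos hw, zero_smul, add_zero, ne_eq, OfNat.ofNat_ne_zero,
          not_false_eq_true, zero_pow]
        rw [hw, ← hvdef, hA, coeff_X_mul_pderiv_self]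
        exact mul_ne_zero hcoeff h2
      · have hcoeff := (hFin w).1
        rw [if_neg hw, mem_support_iff] at hcoeff
        simpa [hH₀, if_neg hw] using hcoeff
    · intro w w' hlt
      simp only [zero_smul, add_zero, ne_eq, OfNat.ofNat_ne_zero, not_false_eq_true, zero_pow, hH₀]
      split_ifs with hw
      · simp only [hA, coeff_X_mul']
        split_ifs with hk
        · rw [coeff_pderiv]
          have hle : Finsupp.single k 1 ≤ w'.1 := by
            rw [Finsupp.single_le_iff]
            exact Nat.one_le_iff_ne_zero.2 (Finsupp.mem_support_iff.1 hk)
          convert zero_mul _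
          by_contra hne
          have hlt' : RevLexLt n m (w'.1 - Finsupp.single k 1 + Finsupp.single j 1) := by
            rwa [← hmdef, RevLexLt.add_right_iff,
              ← RevLexLt.add_right_iff (w := Finsupp.single k 1), tsub_add_cancel_of_le hle,
              hvdef, ← hw]
          have h := (hFin w).2 _ (mem_support_iff.2 hne)
          rw [if_pos hw] at h
          refine (h ?_).asymm hlt'
          intro h'
          rw [h'] at hlt'
          exact hlt'.irrefl
        · rfl
      · by_contra hne
        have h := (hFin w).2 _ (mem_support_iff.2 hne)
        rw [if_neg hw] at h
        refine (h ?_).asymm hlt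
        intro h'
        rw [h'] at hlt
        exact hlt.irrefl
  obtain ⟨t, ht⟩ : ∃ t, (Polynomial.X * (D.det * p)).eval t ≠ 0 := by
    by_contra! h
    exact mul_ne_zero Polynomial.X_ne_zero (mul_ne_zero hDne hp)
      (Polynomial.funext (by simpa using h))
  simp only [Polynomial.eval_mul, Polynomial.eval_X, mul_ne_zero_iff] at ht
  obtain ⟨ht0, htD, htp⟩ := ht
  rw [hDeval] at htD
  set N : Matrix W W K := Matrix.of fun w w' : W =>
    coeff w'.1 (H₀ w + t • H₁ w + t ^ 2 • H₂ w) with hN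
  set φ := coordChange n (Matrix.transvection j k t) with hφ
  have hdet : IsUnit (Matrix.transvection j k t).det := by
    rw [Matrix.det_transvection_of_ne j k hkj.ne']
    exact isUnit_one
  set c : W → K := fun w => if w.1 = v then t⁻¹ else 1 with hc
  have hcoeffN : ∀ w w' : W, coeff w'.1 (c w • φ (F w)) = N w w' := by
    intro w w'
    rw [hφ, hB, hN, Matrix.of_apply]
    by_cases hw : w.1 = v
    · simp only [hc, hH₀, hH₁, hH₂, if_pos hw, coeff_smul, coeff_add, hvF w w' hw, smul_eq_mul,
        coeff_zero]
      field_simp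
      ring
    · simp only [hc, hH₀, hH₁, hH₂, if_neg hw, one_smul, hA]
  obtain ⟨y, hy⟩ : ∃ y : W → K, Matrix.vecMul y N = Pi.single ⟨v, (hW v).2 (Or.inl rfl)⟩ 1 :=
    ⟨Matrix.vecMul (Pi.single _ 1) N⁻¹, by
      rw [Matrix.vecMul_vecMul, Matrix.nonsing_inv_mul _ (isUnit_iff_ne_zero.2 htD),
        Matrix.vecMul_one]⟩
  set E := ∑ w, y w • c w • φ (F w) with hE
  have hEI : E ∈ I.map φ := Submodule.sum_mem _ fun w _ =>
    Submodule.smul_of_tower_mem _ _ (Submodule.smul_of_tower_mem _ _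
      (Ideal.mem_map_of_mem _ (hFI w)))
  have hEhom : E.IsHomogeneous 2 := Submodule.sum_mem (homogeneousSubmodule (Fin n) K 2)
    fun w _ => Submodule.smul_mem _ _
      (Submodule.smul_mem _ _ (isHomogeneous_coordChange _ (hFhom w)))
  have hEcoeff : ∀ w' : W, coeff w'.1 E = (Pi.single ⟨v, (hW v).2 (Or.inl rfl)⟩ 1 : W → K) w' := by
    intro w'
    rw [← hy, hE, coeff_sum]
    exact Finset.sum_congr rfl fun w _ => by rw [coeff_smul, hcoeffN, smul_eq_mul]
  have hEv := hEcoeff ⟨v, (hW v).2 (Or.inl rfl)⟩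
  rw [Pi.single_eq_same] at hEv
  obtain ⟨u, hu⟩ := exists_isInitialMonomial (n := n) (f := E) (by
    rintro h
    rw [h, coeff_zero] at hEv
    exact zero_ne_one hEv)
  have huG : monomial u (1 : K) ∈ G := by
    rw [← hG t htp]
    exact monomial_mem_initialIdeal.2 ⟨E, hEI, hu⟩
  have huv : u ≠ v := by
    rintro rfl
    exact hv huG
  have hud : u.degree = 2 := by
    by_contra h
    exact mem_support_iff.1 hu.1 (hEhom.coeff_eq_zero h)
  have huW : u ∈ W := (hW u).2 (Or.inr ⟨hud, hu.2 v (by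
    rw [mem_support_iff, hEv]
    exact one_ne_zero) huv.symm, huG⟩)
  have h0 := hEcoeff ⟨u, huW⟩
  rw [Pi.single_eq_of_ne (by simpa using huv)] at h0
  exact mem_support_iff.1 hu.1 h0

/-- A nonzero polynomial in the entries of a matrix is nonzero at some invertible matrix. -/
theorem exists_isUnit_det_eval_ne_zero [Infinite K] {p : MvPolynomial (Fin n × Fin n) K}
    (hp : p ≠ 0) : ∃ g : Matrix (Fin n) (Fin n) K, IsUnit g.det ∧
      eval (fun ij => g ij.1 ij.2) p ≠ 0 := by
  by_contra! h
  refine mul_ne_zero (Matrix.det_mvPolynomialX_ne_zero (Fin n) K) hp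
    (MvPolynomial.funext fun x => ?_)
  have hdet : eval x (Matrix.mvPolynomialX (Fin n) (Fin n) K).det =
      (Matrix.of fun i j => x (i, j)).det := by
    rw [RingHom.map_det]
    congr 1
    ext i j
    simp [Matrix.mvPolynomialX]
  rw [map_mul, map_zero, hdet, mul_eq_zero, or_iff_not_imp_left]
  exact fun hne => h (Matrix.of fun i j => x (i, j)) (isUnit_iff_ne_zero.2 hne)

/-- The quadratic part of a generic initial ideal is stable. -/
theorem IsGin.X_mul_X_mem [Infinite K] (hchar : (2 : K) ≠ 0)
    {Q G : Ideal (MvPolynomial (Fin n) K)}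
    (hQ : Q.IsHomogeneous (homogeneousSubmodule (Fin n) K)) (hG : IsGin n Q G)
    {i j k : Fin n} (hkj : k < j) (hij : X i * X j ∈ G) : X i * X k ∈ G := by
  obtain ⟨p, hp, hG⟩ := hG
  obtain ⟨g, hg, hgp⟩ := exists_isUnit_det_eval_ne_zero hp
  set P : Polynomial K := MvPolynomial.aeval (fun ab => Polynomial.C (g ab.1 ab.2) +
    Polynomial.X * Polynomial.C ((g * Matrix.single j k (1 : K) : Matrix _ _ K) ab.1 ab.2)) p with hP
  have hPeval : ∀ t, P.eval t =
      eval (fun ab => (g * Matrix.transvection j k t) ab.1 ab.2) p := by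
    intro t
    rw [hP, ← Polynomial.coe_aeval_eq_eval, comp_aeval_apply, ← MvPolynomial.aeval_eq_eval]
    congr 2
    ext ab
    have : Matrix.single j k t = t • Matrix.single j k (1 : K) := by simp
    rw [Matrix.transvection, this, mul_add, mul_one, Matrix.mul_smul]
    simpa using mul_comm _ _
  rw [X, X, monomial_mul, mul_one] at hij ⊢
  refine monomial_mem_of_forall_transvection hchar (isHomogeneous_map_coordChange hg hQ)
    (hG g hg hgp) hkj (p := P) ?_ (fun t ht => ?_) i hij
  · intro h0
    have h := hPeval 0
    rw [h0, Polynomial.eval_zero, Matrix.transvection_zero, mul_one] at h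
    exact hgp h.symm
  · have hgt : IsUnit (g * Matrix.transvection j k t).det := by
      rwa [Matrix.det_mul, Matrix.det_transvection_of_ne j k hkj.ne', mul_one]
    rw [← hG _ hgt (hPeval t ▸ ht), ← coordChange_comp]
    congr 1
    exact Ideal.map_map _ _

end Borel

section Generic

variable {K : Type} [Field K] {n : ℕ}

/-- An element `f` modulo `J` is killed by a power of every `x` contained in all associated
primes of `J` containing some fixed `y` with `y * f ∈ J`. -/
theorem exists_pow_mul_mem_of_forall_associatedPrimes {R : Type*} [CommRing R] [IsNoetherianRing R]
    {J : Ideal R} {x y : R}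
    (hxy : ∀ P ∈ associatedPrimes R (R ⧸ J), y ∈ P → x ∈ P) {f : R} (hf : y * f ∈ J) :
    ∃ N : ℕ, x ^ N * f ∈ J := by
  set N : Submodule R (R ⧸ J) := Submodule.span R {Ideal.Quotient.mk J f} with hN
  have hann : ∀ a, a ∈ Module.annihilator R N ↔ a * f ∈ J := by
    intro a
    rw [← Submodule.annihilator, hN, Submodule.mem_annihilator_span_singleton,
      ← Ideal.Quotient.eq_zero_iff_mem, map_mul]
    rfl
  have hrad : x ∈ (Module.annihilator R N).radical := by
    rw [← Ideal.sInf_minimalPrimes, Ideal.mem_sInf]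
    intro P hP
    refine hxy P ?_ (hP.1.2 ((hann y).2 hf))
    exact associatedPrimes.subset_of_injective N.injective_subtype
      (Module.associatedPrimes.minimalPrimes_annihilator_subset_associatedPrimes R N hP)
  obtain ⟨m, hm⟩ := hrad
  exact ⟨m, (hann _).1 hm⟩

theorem exists_linear_polynomial_of_notMem {P : Ideal (MvPolynomial (Fin n) K)}
    {l : Fin n} (hl : X l ∉ P) :
    ∃ q : MvPolynomial (Fin n) K, q ≠ 0 ∧
      ∀ v : Fin n → K, ∑ j, v j • X j ∈ P → eval v q = 0 := by
  set ψ : (Fin n → K) →ₗ[K] MvPolynomial (Fin n) K := Fintype.linearCombination K X with hψ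
  have hψv : ∀ v, ψ v = ∑ j, v j • X j := fun v => rfl
  obtain ⟨φ, hφ, hle⟩ := Submodule.exists_le_ker_of_lt_top
    ((P.restrictScalars K).comap ψ) (lt_top_iff_ne_top.2 fun htop => hl (by
      have : Pi.single l (1 : K) ∈ (P.restrictScalars K).comap ψ := htop ▸ Submodule.mem_top
      rw [Submodule.mem_comap, hψv] at this
      simpa [Pi.single_apply, ite_smul] using this))
  have heval : ∀ v : Fin n → K, eval v (∑ j, φ (Pi.single j 1) • X j : MvPolynomial (Fin n) K) =
      φ v := by
    intro v
    rw [map_sum]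
    conv_rhs => rw [← Finset.univ_sum_single v, map_sum]
    refine Finset.sum_congr rfl fun j _ => ?_
    rw [smul_eval, eval_X, mul_comm, ← smul_eq_mul, ← map_smul]
    congr 1
    ext i
    simp [Pi.single_apply]
  refine ⟨∑ j, φ (Pi.single j 1) • X j, ?_, fun v hv => ?_⟩
  · intro h0
    refine hφ (LinearMap.ext fun v => ?_)
    rw [← heval, h0, map_zero, LinearMap.zero_apply]
  · rw [heval]
    exact hle (show ψ v ∈ P from hv)

theorem exists_linear_form_saturated [Infinite K] (J : Ideal (MvPolynomial (Fin n) K))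
    {q : MvPolynomial (Fin n) K} (hq : q ≠ 0) :
    ∃ v : Fin n → K, eval v q ≠ 0 ∧ ∀ f, (∑ j, v j • X j) * f ∈ J →
      ∀ w : Fin n → K, ∃ N : ℕ, (∑ j, w j • X j) ^ N * f ∈ J := by
  set S := associatedPrimes (MvPolynomial (Fin n) K) (MvPolynomial (Fin n) K ⧸ J)
  have hS : S.Finite := associatedPrimes.finite _ _
  have hlin : ∀ P : Ideal (MvPolynomial (Fin n) K), ∃ q : MvPolynomial (Fin n) K, q ≠ 0 ∧
      ∀ v : Fin n → K, eval v q ≠ 0 → ∑ j, v j • X j ∈ P → ∀ l, X l ∈ P := by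
    intro P
    by_cases h : ∀ l, X l ∈ P
    · exact ⟨1, one_ne_zero, fun _ _ _ => h⟩
    · push Not at h
      obtain ⟨l, hl⟩ := h
      obtain ⟨q, hq, hqv⟩ := exists_linear_polynomial_of_notMem hl
      exact ⟨q, hq, fun v hv hvP => absurd (hqv v hvP) hv⟩
  choose a ha0 ha using hlin
  obtain ⟨v, hv⟩ : ∃ v, eval v (q * ∏ P ∈ hS.toFinset, a P) ≠ 0 := by
    by_contra! h
    exact mul_ne_zero hq (Finset.prod_ne_zero_iff.2 fun P _ => ha0 P)
      (MvPolynomial.funext fun v => by rw [h v, map_zero])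
  rw [map_mul, map_prod, mul_ne_zero_iff, Finset.prod_ne_zero_iff] at hv
  exact ⟨v, hv.1, fun f hf w => exists_pow_mul_mem_of_forall_associatedPrimes
    (fun P hP hy => Submodule.sum_mem _ fun l _ => Submodule.smul_of_tower_mem _ _
      (ha P v (hv.2 P (hS.mem_toFinset.2 hP)) hy l)) hf⟩

theorem map_tailIdeal_congr {g h : Matrix (Fin n) (Fin n) K} {k : ℕ}
    (hgh : ∀ l : Fin n, k ≤ l → g l = h l) :
    (tailIdeal K n k).map (coordChange n g) = (tailIdeal K n k).map (coordChange n h) := by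
  rw [tailIdeal, Ideal.map_span, Ideal.map_span, Set.image_image, Set.image_image]
  congr 1
  refine Set.image_congr fun l hl => ?_
  rw [coordChange_X, coordChange_X, hgh l hl]

theorem map_coordChange_smul_one_tailIdeal {c : K} (hc : c ≠ 0) (k : ℕ) :
    (tailIdeal K n k).map (coordChange n (c • (1 : Matrix (Fin n) (Fin n) K))) =
      tailIdeal K n k := by
  have hX : ∀ l, coordChange n (c • (1 : Matrix (Fin n) (Fin n) K)) (X l) = c • X l := by
    intro l
    rw [coordChange_X]
    simp [Matrix.one_apply, ite_smul]
  refine le_antisymm ?_ ?_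
  · rw [tailIdeal, Ideal.map_span, Ideal.span_le]
    rintro _ ⟨_, ⟨l, hl, rfl⟩, rfl⟩
    rw [SetLike.mem_coe, hX]
    exact Submodule.smul_of_tower_mem _ _ (Ideal.subset_span ⟨l, hl, rfl⟩)
  · conv_lhs => rw [tailIdeal]
    rw [Ideal.span_le]
    rintro _ ⟨l, hl, rfl⟩
    have := Submodule.smul_of_tower_mem _ c⁻¹ (Ideal.mem_map_of_mem
      (coordChange n (c • (1 : Matrix (Fin n) (Fin n) K)))
      (Ideal.subset_span ⟨l, hl, rfl⟩ : X l ∈ tailIdeal K n k))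
    rwa [hX, smul_smul, inv_mul_cancel₀ hc, one_smul] at this

/-- In the coordinates given by `h`, the variables with index at least `m`, taken in decreasing
order, form a filter-regular sequence modulo `Q`. -/
def IsFilterRegularFrom (Q : Ideal (MvPolynomial (Fin n) K)) (h : Matrix (Fin n) (Fin n) K)
    (m : ℕ) : Prop :=
  ∀ k : Fin n, m ≤ k → ∀ f,
    coordChange n h (X k) * f ∈ Q ⊔ (tailIdeal K n (k + 1)).map (coordChange n h) →
      ∀ w : Fin n → K, ∃ N : ℕ,
        (∑ j, w j • X j) ^ N * f ∈ Q ⊔ (tailIdeal K n (k + 1)).map (coordChange n h)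

theorem exists_isFilterRegularFrom [Infinite K] (Q : Ideal (MvPolynomial (Fin n) K))
    {F : MvPolynomial (Fin n × Fin n) K} (hF : F ≠ 0) (r : ℕ) :
    ∃ h : Matrix (Fin n) (Fin n) K, eval (fun ij => h ij.1 ij.2) F ≠ 0 ∧
      IsFilterRegularFrom Q h (n - r) := by
  induction r with
  | zero =>
    obtain ⟨h, -, hF⟩ := exists_isUnit_det_eval_ne_zero hF
    exact ⟨h, hF, fun k hk => absurd k.2 (by omega)⟩
  | succ r ih =>
    obtain ⟨h, hhF, hh⟩ := ih
    by_cases hr : r < n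
    swap
    · exact ⟨h, hhF, by rwa [show n - (r + 1) = n - r by omega]⟩
    set k₀ : Fin n := ⟨n - (r + 1), by omega⟩ with hk₀
    set q : MvPolynomial (Fin n) K :=
      aeval (fun ab : Fin n × Fin n => if ab.1 = k₀ then X ab.2 else C (h ab.1 ab.2)) F with hq
    have hqeval : ∀ v, eval v q = eval (fun ab => (h.updateRow k₀ v) ab.1 ab.2) F := by
      intro v
      rw [hq, ← MvPolynomial.aeval_eq_eval, ← MvPolynomial.aeval_eq_eval, comp_aeval_apply]
      congr 2
      ext ab
      by_cases hab : ab.1 = k₀ <;> simp [hab, Matrix.updateRow_apply]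
    obtain ⟨v, hv, hsat⟩ := exists_linear_form_saturated
      (Q ⊔ (tailIdeal K n (k₀ + 1)).map (coordChange n h)) (q := q) (by
        intro h0
        have := hqeval (h k₀)
        rw [h0, map_zero, Matrix.updateRow_eq_self] at this
        exact hhF this.symm)
    have htail : ∀ m : ℕ, (k₀ : ℕ) < m →
        (tailIdeal K n m).map (coordChange n (h.updateRow k₀ v)) =
        (tailIdeal K n m).map (coordChange n h) := fun m hm =>
      map_tailIdeal_congr fun l hl => Matrix.updateRow_ne (by
        rintro rfl
        omega)
    refine ⟨h.updateRow k₀ v, hqeval v ▸ hv, fun k hk => ?_⟩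
    rcases eq_or_ne k k₀ with rfl | hne
    · rw [htail _ (Nat.lt_succ_self _), coordChange_X, Matrix.updateRow_self]
      exact hsat
    · have hlt : (k₀ : ℕ) < k := lt_of_le_of_ne hk fun h => hne (Fin.ext h.symm)
      rw [htail _ (hlt.trans (Nat.lt_succ_self _)), coordChange_X, Matrix.updateRow_ne hne,
        ← coordChange_X]
      exact hh k (by simp only [hk₀] at hlt; omega)

theorem exists_generic_coordinates [Infinite K] (Q : Ideal (MvPolynomial (Fin n) K))
    {p : MvPolynomial (Fin n × Fin n) K} (hp : p ≠ 0) :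
    ∃ (g h : Matrix (Fin n) (Fin n) K) (c : K), c ≠ 0 ∧ h * g = c • 1 ∧ IsUnit g.det ∧
      IsUnit h.det ∧ eval (fun ij => g ij.1 ij.2) p ≠ 0 ∧ IsFilterRegularFrom Q h 0 := by
  obtain ⟨g, hg, hgp⟩ := exists_isUnit_det_eval_ne_zero hp
  set A := (Matrix.mvPolynomialX (Fin n) (Fin n) K) with hA
  set F : MvPolynomial (Fin n × Fin n) K :=
    A.det * aeval (fun ab => C g.det * A.adjugate ab.1 ab.2) p with hF
  have hFeval : ∀ h : Matrix (Fin n) (Fin n) K, eval (fun ij => h ij.1 ij.2) F =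
      h.det * eval (fun ij => (g.det • h.adjugate) ij.1 ij.2) p := by
    intro h
    have hAh : A.map (eval fun ij => h ij.1 ij.2) = h := Matrix.mvPolynomialX_map_eval₂ _ _
    rw [hF, map_mul, RingHom.map_det, RingHom.mapMatrix_apply, hAh]
    congr 1
    rw [← MvPolynomial.aeval_eq_eval, ← MvPolynomial.aeval_eq_eval, comp_aeval_apply]
    congr 2
    ext ab
    have := congrFun (congrFun (RingHom.map_adjugate (eval fun ij => h ij.1 ij.2) A) ab.1) ab.2
    rw [RingHom.mapMatrix_apply, RingHom.mapMatrix_apply, hAh] at this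
    simp [MvPolynomial.aeval_eq_eval, ← this]
  have hdet : g.det ≠ 0 := hg.ne_zero
  have hF0 : F ≠ 0 := by
    intro h0
    have h := hFeval g⁻¹
    rw [h0, map_zero] at h
    refine mul_ne_zero ?_ ?_ h.symm
    · exact ((Matrix.isUnit_nonsing_inv_det_iff).2 hg).ne_zero
    · have : g.det • g⁻¹.adjugate = g := by
        rw [← Matrix.mul_one g⁻¹.adjugate, ← Matrix.nonsing_inv_mul g hg, ← mul_assoc,
          Matrix.adjugate_mul, Matrix.smul_mul, one_mul, smul_smul, Matrix.det_nonsing_inv,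
          Ring.mul_inverse_cancel _ hg, one_smul]
      rwa [this]
  obtain ⟨h, hh, hreg⟩ := exists_isFilterRegularFrom Q hF0 n
  rw [hFeval, mul_ne_zero_iff] at hh
  refine ⟨g.det • h.adjugate, h, g.det * h.det, mul_ne_zero hdet hh.1, ?_, ?_,
    isUnit_iff_ne_zero.2 hh.1, hh.2, by simpa using hreg⟩
  · rw [Matrix.mul_smul, Matrix.mul_adjugate, smul_smul]
  · rw [isUnit_iff_ne_zero, Matrix.det_smul, Matrix.det_adjugate]
    exact mul_ne_zero (pow_ne_zero _ hdet) (pow_ne_zero _ hh.1)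

end Generic

section LinearComplex

theorem Finsupp.mem_ideal_smul_top_iff {R τ : Type*} [CommRing R] {I : Ideal R} {a : τ →₀ R} :
    a ∈ I • (⊤ : Submodule R (τ →₀ R)) ↔ ∀ i, a i ∈ I := by
  refine ⟨fun ha i => ?_, fun ha => ?_⟩
  · refine Submodule.smul_induction_on ha (fun r hr m _ => ?_) fun x y hx hy => ?_
    · exact I.mul_mem_right _ hr
    · exact I.add_mem hx hy
  · rw [← a.sum_single]
    refine Submodule.sum_mem _ fun i _ => ?_
    have := Submodule.smul_mem_smul (ha i)
      (Submodule.mem_top : Finsupp.single i (1 : R) ∈ (⊤ : Submodule R (τ →₀ R)))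
    rwa [Finsupp.smul_single, smul_eq_mul, mul_one] at this

variable {K : Type} [Field K] {n : ℕ}

theorem tailIdeal_zero : tailIdeal K n 0 = idealOfVars (Fin n) K := by
  rw [tailIdeal]
  congr 1
  ext
  simp

theorem homogeneousComponent_eq_zero_of_mem_pow {σ : Type*} {d t : ℕ} {f : MvPolynomial σ K}
    (hf : f ∈ idealOfVars σ K ^ d) (ht : t < d) : homogeneousComponent t f = 0 := by
  ext u
  rw [coeff_homogeneousComponent, coeff_zero]
  split_ifs with hu
  · exact (mem_pow_idealOfVars_iff' _ _).1 hf u (hu.trans_lt ht)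
  · rfl

theorem mapRange_homogeneousComponent_map {τ τ' : Type} {e : ℕ}
    {δ : (τ →₀ MvPolynomial (Fin n) K) →ₗ[MvPolynomial (Fin n) K] (τ' →₀ MvPolynomial (Fin n) K)}
    (hδ : ∀ x i, (δ (Finsupp.single x 1) i).IsHomogeneous e) (t : ℕ)
    (b : τ →₀ MvPolynomial (Fin n) K) (i : τ') :
    homogeneousComponent (t + e) (δ b i) =
      δ (Finsupp.mapRange.linearMap (homogeneousComponent t) b) i := by
  have hsingle : ∀ x f, δ (Finsupp.single x f) i = f * δ (Finsupp.single x 1) i := by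
    intro x f
    rw [← smul_eq_mul, ← Finsupp.smul_apply, ← map_smul, Finsupp.smul_single, smul_eq_mul, mul_one]
  induction b using Finsupp.induction_linear with
  | zero => simp
  | add f g hf hg => simp only [map_add, Finsupp.add_apply, hf, hg]
  | single x f =>
    rw [Finsupp.mapRange.linearMap_apply, Finsupp.mapRange_single, hsingle, hsingle x
      (homogeneousComponent t f), homogeneousComponent_add_mul_of_isHomogeneous _ (hδ x i)]

theorem isHomogeneous_map_coordChange_tailIdeal {h : Matrix (Fin n) (Fin n) K}
    (hh : IsUnit h.det) (k : ℕ) : ((tailIdeal K n k).map (coordChange n h)).IsHomogeneous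
      (homogeneousSubmodule (Fin n) K) :=
  isHomogeneous_map_coordChange hh (isHomogeneous_tailIdeal k)

theorem mem_tailIdeal_of_X_mul_mem {k : Fin n} {f : MvPolynomial (Fin n) K}
    (hf : X k * f ∈ tailIdeal K n (k + 1)) : f ∈ tailIdeal K n (k + 1) := by
  rw [mem_tailIdeal] at hf ⊢
  intro u hu
  obtain ⟨l, hl, hul⟩ := hf (Finsupp.single k 1 + u) (by
    rw [mem_support_iff, coeff_X_mul]
    exact mem_support_iff.1 hu)
  refine ⟨l, hl, ?_⟩
  have hlk : l ≠ k := by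
    rintro rfl
    omega
  rwa [Finsupp.add_apply, Finsupp.single_eq_of_ne hlk, zero_add] at hul

/-- Multiplication by a variable in filter-regular coordinates is injective in degrees at least
`e 0` modulo `Q` and the later variables, if `Q` has a free resolution with linear maps whose
augmentation `δ 0` has degree `e 0`. -/
theorem mem_of_coordChange_X_mul_mem {h : Matrix (Fin n) (Fin n) K} (hh : IsUnit h.det)
    {Q : Ideal (MvPolynomial (Fin n) K)} (hQ : IsFilterRegularFrom Q h 0)
    {τ : ℕ → Type} [Unique (τ 0)]
    {δ : ∀ s, (τ (s + 1) →₀ MvPolynomial (Fin n) K) →ₗ[MvPolynomial (Fin n) K]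
      (τ s →₀ MvPolynomial (Fin n) K)}
    (hδQ : ∀ a, a ∈ LinearMap.range (δ 0) ↔ a default ∈ Q)
    (hex : ∀ s, LinearMap.range (δ (s + 1)) = LinearMap.ker (δ s))
    {e : ℕ → ℕ} (he' : ∀ s, e (s + 1) = 1)
    (hδ : ∀ s x i, (δ s (Finsupp.single x 1) i).IsHomogeneous (e s))
    (k : Fin n) {f : MvPolynomial (Fin n) K} (hf : f ∈ idealOfVars (Fin n) K ^ e 0)
    (hkf : coordChange n h (X k) * f ∈ Q ⊔ (tailIdeal K n (k + 1)).map (coordChange n h)) :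
    f ∈ Q ⊔ (tailIdeal K n (k + 1)).map (coordChange n h) := by
  set L : ℕ → Ideal (MvPolynomial (Fin n) K) :=
    fun k => (tailIdeal K n k).map (coordChange n h) with hL
  set y : ℕ → MvPolynomial (Fin n) K :=
    fun k => if hk : k < n then coordChange n h (X ⟨k, hk⟩) else 0 with hy
  have hyk : ∀ k : Fin n, y k = coordChange n h (X k) := fun k => dif_pos k.2
  have hmem : ∀ k (a : τ 0 →₀ MvPolynomial (Fin n) K),
      a ∈ L k • (⊤ : Submodule (MvPolynomial (Fin n) K) (τ 0 →₀ MvPolynomial (Fin n) K)) ⊔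
        LinearMap.range (δ 0) ↔ a default ∈ Q ⊔ L k := by
    intro k a
    rw [sup_comm]
    constructor
    · intro ha
      obtain ⟨b, hb, c, hc, rfl⟩ := Submodule.mem_sup.1 ha
      exact add_mem (Ideal.mem_sup_left ((hδQ b).1 hb))
        (Ideal.mem_sup_right (Finsupp.mem_ideal_smul_top_iff.1 hc _))
    · intro ha
      obtain ⟨b, hb, c, hc, hbc⟩ := Submodule.mem_sup.1 ha
      have : a = Finsupp.single default b + Finsupp.single default c := by
        rw [← Finsupp.single_add, hbc]
        exact Finsupp.unique_single a
      rw [this]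
      refine add_mem (Submodule.mem_sup_left ((hδQ _).2 ?_))
        (Submodule.mem_sup_right (Finsupp.mem_ideal_smul_top_iff.2 fun i => ?_))
      · rwa [Finsupp.single_eq_same]
      · rwa [Unique.eq_default i, Finsupp.single_eq_same]
  have hsmul : ∀ {τ : Type} (r : MvPolynomial (Fin n) K) (a : τ →₀ MvPolynomial (Fin n) K) (i : τ),
      (r • a) i = r * a i := fun r a i => rfl
  have key := mem_of_smul_mem_of_linear (M := fun s => τ s →₀ MvPolynomial (Fin n) K) (δ := δ)
    (n := n) (y := y) (L := L) (fun s => (idealOfVars (Fin n) K ^ e s) • ⊤)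
    ?_ ?_ ?_ hex ?_ ?_ ?_ k k.2 (Finsupp.single default f) ?_ ?_
  · rwa [hmem, Finsupp.single_eq_same] at key
  · have : tailIdeal K n n = ⊥ := by
      rw [tailIdeal, Ideal.span_eq_bot]
      rintro _ ⟨l, hl, rfl⟩
      exact absurd l.2 (not_lt.2 hl)
    rw [hL]
    simp only [this, Ideal.map_bot]
  · intro k hk
    have := tailIdeal_eq_sup (K := K) ⟨k, hk⟩
    simp only [hL]
    rw [this, Ideal.map_sup, Ideal.map_span _ {X _}, Set.image_singleton, ← hyk]
  · intro k hk s a ha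
    rw [Finsupp.mem_ideal_smul_top_iff] at ha ⊢
    intro i
    have hi := ha i
    rw [hsmul, hyk ⟨k, hk⟩, hL, mem_map_coordChange hh] at hi
    obtain ⟨q, hq, hqa⟩ := hi
    obtain ⟨b, hb⟩ := coordChange_surjective hh (a i)
    rw [← hb, ← map_mul] at hqa
    rw [coordChange_injective hh hqa] at hq
    rw [← hb]
    have hb' : b ∈ tailIdeal K n (k + 1) := mem_tailIdeal_of_X_mul_mem (k := ⟨k, hk⟩) hq
    exact Ideal.mem_map_of_mem _ hb'
  · intro k hk a ha l hl
    rw [hmem, hsmul, hyk ⟨k, hk⟩] at ha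
    obtain ⟨N, hN⟩ := hQ ⟨k, hk⟩ (Nat.zero_le _) _ ha (h ⟨l, hl⟩)
    refine ⟨N, ?_⟩
    rwa [hmem, hsmul, hyk ⟨l, hl⟩, coordChange_X]
  · intro s
    refine Submodule.smul_mono_left ?_
    rw [he', pow_one, Ideal.span_le]
    rintro _ ⟨l, rfl⟩
    refine (mem_map_coordChange hh).2 ⟨coordChange n h⁻¹ (X l), ?_, ?_⟩
    · rw [tailIdeal_zero, coordChange_X]
      exact Submodule.sum_mem _ fun m _ =>
        Submodule.smul_of_tower_mem _ _ (Ideal.subset_span ⟨m, rfl⟩)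
    · rw [← coordChange_mul_apply, Matrix.nonsing_inv_mul _ hh, coordChange_one]
      rfl
  · intro k hk s a ha b hab
    set b₀ := Finsupp.mapRange.linearMap (homogeneousComponent (σ := Fin n) (R := K) 0) b with hb₀
    rw [Finsupp.mem_ideal_smul_top_iff] at ha hab
    refine ⟨b - b₀, ?_, ?_⟩
    · rw [Finsupp.mem_ideal_smul_top_iff]
      intro i
      rw [he', mem_pow_idealOfVars_iff']
      intro u hu
      have hu0 : u.degree = 0 := by omega
      rw [Finsupp.sub_apply, coeff_sub, hb₀, Finsupp.mapRange.linearMap_apply,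
        Finsupp.mapRange_apply, coeff_homogeneousComponent, if_pos hu0, sub_self]
    · rw [Finsupp.mem_ideal_smul_top_iff]
      intro i
      have h1 : δ s b₀ i = homogeneousComponent (e s) (δ s b i) := by
        rw [hb₀, ← mapRange_homogeneousComponent_map (hδ s), zero_add]
      have h2 : homogeneousComponent (e s) ((y k • a - δ s b) i) = - δ s b₀ i := by
        rw [Finsupp.sub_apply, map_sub, h1, homogeneousComponent_eq_zero_of_mem_pow
          (d := e s + 1), zero_sub]
        · rw [hsmul, pow_succ']
          refine Ideal.mul_mem_mul ?_ (ha i)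
          rw [← pow_one (idealOfVars (Fin n) K), mem_pow_idealOfVars_iff']
          intro u hu
          rw [hyk ⟨k, hk⟩, coordChange_X]
          exact (isHomogeneous_sum_smul_X _).coeff_eq_zero (by omega)
        · exact Nat.lt_succ_self _
      have h3 : (y k • a - δ s (b - b₀)) i = (y k • a - δ s b) i -
          homogeneousComponent (e s) ((y k • a - δ s b) i) := by
        rw [h2, map_sub]
        simp only [Finsupp.sub_apply]
        ring
      rw [h3]
      exact sub_mem (hab i) (homogeneousComponent_mem_of_mem
        (isHomogeneous_map_coordChange_tailIdeal hh _) (hab i) _)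
  · rw [Finsupp.mem_ideal_smul_top_iff]
    intro i
    rwa [Unique.eq_default i, Finsupp.single_eq_same]
  · rwa [hmem, hsmul, Finsupp.single_eq_same, hyk]

end LinearComplex

section LinearResolution

variable {K : Type} [Field K] {n : ℕ}

theorem mem_polyGrading_natCast {d : ℕ} {f : MvPolynomial (Fin n) K} :
    f ∈ polyGrading K n d ↔ f.IsHomogeneous d := by
  rw [polyGrading, if_pos (Int.natCast_nonneg d), Int.toNat_natCast]
  rfl

theorem single_one_mem_freeGrading {σ : Type} (deg : σ → ℤ) (x : σ) :
    (Finsupp.single x 1 : σ →₀ MvPolynomial (Fin n) K) ∈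
      freeGrading (polyGrading K n) deg (deg x) := by
  intro x'
  rcases eq_or_ne x' x with rfl | hne
  · rw [Finsupp.single_eq_same, sub_self]
    exact mem_polyGrading_natCast (d := 0).2 (isHomogeneous_one _ _)
  · rw [Finsupp.single_eq_of_ne hne]
    exact zero_mem _

/-- The index types of the bases in a free resolution of an ideal, augmented by the ring. -/
def AugmentedIndex (σ : ℕ → Type) : ℕ → Type
  | 0 => Unit
  | s + 1 => σ s

instance (σ : ℕ → Type) : Unique (AugmentedIndex σ 0) := inferInstanceAs (Unique Unit)

/-- The differentials in a free resolution of an ideal, augmented by the map to the ring. -/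
noncomputable def augmentedMap {A : Type} [CommRing A] {Q : Ideal A} {σ : ℕ → Type}
    (aug : (σ 0 →₀ A) →ₗ[A] Q) (d : ∀ s, (σ (s + 1) →₀ A) →ₗ[A] (σ s →₀ A)) :
    ∀ s, (AugmentedIndex σ (s + 1) →₀ A) →ₗ[A] (AugmentedIndex σ s →₀ A)
  | 0 => (Finsupp.lsingle () : A →ₗ[A] (Unit →₀ A)) ∘ₗ Q.subtype ∘ₗ aug
  | s + 1 => d s

/-- `Q` has a `2`-linear free resolution. -/
abbrev TwoLinearResolution (Q : Ideal (MvPolynomial (Fin n) K)) :=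
  GradedFreeResolution K (MvPolynomial (Fin n) K) (polyGrading K n) ↥Q
    (idealGrading (polyGrading K n) Q) (fun i => {k : ℤ | k = (i : ℤ) + 2})

variable {Q : Ideal (MvPolynomial (Fin n) K)}


theorem TwoLinearResolution.isHomogeneous_aug (res : TwoLinearResolution Q) (x : res.σ 0) :
    (res.aug (Finsupp.single x 1) : MvPolynomial (Fin n) K).IsHomogeneous 2 := by
  have h : (res.aug (Finsupp.single x 1) : MvPolynomial (Fin n) K) ∈
      polyGrading K n (res.deg 0 x) :=
    res.aug_graded _ _ (single_one_mem_freeGrading _ _)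
  have hdeg : res.deg 0 x = ((2 : ℕ) : ℤ) := by simpa using res.deg_mem 0 x
  rwa [hdeg, mem_polyGrading_natCast] at h

theorem TwoLinearResolution.isHomogeneous_d (res : TwoLinearResolution Q) (s : ℕ)
    (x : res.σ (s + 1)) (i : res.σ s) :
    (res.d s (Finsupp.single x 1) i).IsHomogeneous 1 := by
  have h := res.d_graded s _ _ (single_one_mem_freeGrading _ x) i
  have hdeg : res.deg (s + 1) x - res.deg s i = ((1 : ℕ) : ℤ) := by
    have h1 : res.deg (s + 1) x = ((s + 1 : ℕ) : ℤ) + 2 := res.deg_mem (s + 1) x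
    have h2 : res.deg s i = (s : ℤ) + 2 := res.deg_mem s i
    rw [h1, h2]
    push_cast
    ring
  rwa [hdeg, mem_polyGrading_natCast] at h

theorem TwoLinearResolution.le_pow_idealOfVars (res : TwoLinearResolution Q) :
    Q ≤ idealOfVars (Fin n) K ^ 2 := by
  intro f hf
  obtain ⟨b, hb⟩ := res.aug_surjective ⟨f, hf⟩
  have hfb : (res.aug b : MvPolynomial (Fin n) K) = f := by rw [hb]
  rw [← hfb]
  clear hfb hb
  induction b using Finsupp.induction_linear with
  | zero => simp
  | add b c hb hc =>
    rw [map_add]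
    exact add_mem hb hc
  | single x b =>
    rw [← mul_one b, ← smul_eq_mul, ← Finsupp.smul_single, map_smul]
    refine Ideal.mul_mem_left _ b ?_
    rw [mem_pow_idealOfVars_iff']
    exact fun u hu => (isHomogeneous_aug res x).coeff_eq_zero hu.ne

theorem TwoLinearResolution.mem_of_coordChange_X_mul_mem (res : TwoLinearResolution Q)
    {h : Matrix (Fin n) (Fin n) K}
    (hh : IsUnit h.det) (hQ : IsFilterRegularFrom Q h 0)
    (k : Fin n) {f : MvPolynomial (Fin n) K} (hf : f ∈ idealOfVars (Fin n) K ^ 2)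
    (hkf : coordChange n h (X k) * f ∈ Q ⊔ (tailIdeal K n (k + 1)).map (coordChange n h)) :
    f ∈ Q ⊔ (tailIdeal K n (k + 1)).map (coordChange n h) := by
  refine _root_.mem_of_coordChange_X_mul_mem hh hQ (τ := AugmentedIndex res.σ)
    (δ := augmentedMap res.aug res.d) (e := fun s => if s = 0 then 2 else 1) ?_ ?_ ?_ ?_ k hf hkf
  · intro a
    constructor
    · rintro ⟨b, rfl⟩
      change Finsupp.single () (res.aug b : MvPolynomial (Fin n) K) () ∈ Q
      rw [Finsupp.single_eq_same]
      exact (res.aug b).2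
    · intro ha
      obtain ⟨b, hb⟩ := res.aug_surjective ⟨a default, ha⟩
      refine ⟨b, ?_⟩
      change Finsupp.single () (res.aug b : MvPolynomial (Fin n) K) = a
      rw [hb]
      exact (Finsupp.unique_single a).symm
  · rintro (_ | s)
    · change LinearMap.range (res.d 0) = LinearMap.ker
        ((Finsupp.lsingle () : _ →ₗ[MvPolynomial (Fin n) K] (Unit →₀ MvPolynomial (Fin n) K)) ∘ₗ
          Q.subtype ∘ₗ res.aug)
      rw [LinearMap.ker_comp_of_ker_eq_bot _ (LinearMap.ker_eq_bot.2 (Finsupp.single_injective ())),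
        LinearMap.ker_comp_of_ker_eq_bot _ Q.ker_subtype]
      exact res.exact_zero
    · exact res.exact_succ s
  · exact fun s => rfl
  · rintro (_ | s) x i
    · change (Finsupp.single () (res.aug (Finsupp.single x 1) : MvPolynomial (Fin n) K) ()
        ).IsHomogeneous 2
      rw [Finsupp.single_eq_same]
      exact isHomogeneous_aug res x
    · exact isHomogeneous_d res s x i

end LinearResolution

/-- **Lemma.**  Let `K` be an infinite field with `char K ≠ 2` and let
`Q ⊆ K[x_1, …, x_n]` be a homogeneous ideal with a `2`-linear resolution.  Then the
generic initial ideal `Gin(Q)` with respect to the reverse lexicographic order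
induced by `x_1 > ⋯ > x_n` is generated by quadratic monomials and satisfies the
stability condition `(*)`: if `x_i x_j ∈ Gin(Q)` with `i ≤ j`, then
`x_i x_k ∈ Gin(Q)` for all `k < j`. -/
theorem gin_of_two_linear
    (K : Type) [Field K] [Infinite K] (hchar : (2 : K) ≠ 0) (n : ℕ)
    (Q : Ideal (MvPolynomial (Fin n) K))
    (hQhom : Ideal.IsHomogeneous
      (MvPolynomial.homogeneousSubmodule (Fin n) K) Q)
    -- Q has a 2-linear resolution over the polynomial ring
    (hlin : Nonempty (GradedFreeResolution K (MvPolynomial (Fin n) K)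
      (polyGrading K n) ↥Q (idealGrading (polyGrading K n) Q)
      (fun i => {k : ℤ | k = (i : ℤ) + 2})))
    (G : Ideal (MvPolynomial (Fin n) K)) (hG : IsGin n Q G) :
    (G = Ideal.span {m | ∃ u : Fin n →₀ ℕ, expDeg u = 2 ∧
        monomial u (1 : K) ∈ G ∧ m = monomial u (1 : K)}) ∧
    (∀ i j : Fin n, i ≤ j → X i * X j ∈ G →
      ∀ k : Fin n, k < j → X i * X k ∈ G) := by
  refine ⟨?_, fun i j _ hij k hkj => hG.X_mul_X_mem hchar hQhom hkj hij⟩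
  obtain ⟨res⟩ := hlin
  obtain ⟨p, hp, hG⟩ := hG
  obtain ⟨g, h, c, hc, hhg, hg, hh, hgp, hreg⟩ := exists_generic_coordinates Q hp
  have hGg := hG g hg hgp
  have htail : ∀ k, ((tailIdeal K n k).map (coordChange n h)).map (coordChange n g) =
      tailIdeal K n k := by
    intro k
    conv_rhs => rw [← map_coordChange_smul_one_tailIdeal hc, ← hhg, ← coordChange_comp]
    exact Ideal.map_map _ _
  have hX : ∀ k, coordChange n g (coordChange n h (X k)) = c • X k := by
    intro k
    rw [← coordChange_mul_apply, hhg, coordChange_X]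
    simp [Matrix.one_apply, ite_smul]
  have hmem : ∀ k q, coordChange n g q ∈ Q.map (coordChange n g) ⊔ tailIdeal K n k ↔
      q ∈ Q ⊔ (tailIdeal K n k).map (coordChange n h) := by
    intro k q
    conv_lhs => rw [← htail k]
    rw [← Ideal.map_sup, mem_map_coordChange hg]
    exact ⟨fun ⟨q', hq', h⟩ => coordChange_injective hg h ▸ hq', fun hq => ⟨q, hq, rfl⟩⟩
  rw [← hGg]
  refine initialIdeal_eq_span_quadratic (isHomogeneous_map_coordChange hg hQhom) ?_ ?_
  · intro f hf d hd
    obtain ⟨q, hq, rfl⟩ := (mem_map_coordChange hg).1 hf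
    rw [homogeneousComponent_coordChange, homogeneousComponent_eq_zero_of_mem_pow
      (TwoLinearResolution.le_pow_idealOfVars res hq) hd, map_zero]
  · intro k d hd f hf hkf
    obtain ⟨q, rfl⟩ := coordChange_surjective hg f
    rw [hmem]
    refine TwoLinearResolution.mem_of_coordChange_X_mul_mem res hh hreg k ?_ ?_
    · rw [mem_pow_idealOfVars_iff']
      intro u hu
      have : q = homogeneousComponent d q := coordChange_injective hg (by
        rw [← homogeneousComponent_coordChange, homogeneousComponent_eq_self hf])
      rw [this, coeff_homogeneousComponent, if_neg (by omega)]
    · rw [← hmem, map_mul, hX, smul_mul_assoc]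
      exact Submodule.smul_of_tower_mem _ _ hkf
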